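/- arXiv:2404.09085 — 4 statements merged into one kernel-verified Lean document; each statement's English description precedes it below -/
import Mathlib

section
/- For every ε > 0 there is a constant C_ε such that for every function b : O∖{0} → ℂ constant on associate classes, every θ ∈ ℂ∖{0} with |θ| < 2^{1/8}, every c ∈ O∖{0} with |c| < N, and every N > 0, one has |B(θ,c,N)| ≤ C_ε·(N·|c|/|θ|)·N^ε·‖b_N‖₂². -/
open scoped Real ComplexConjugate
open Complex

/-- `e[z] = exp(2πi Re z)`. -/
noncomputable def efn (z : ℂ) : ℂ := Complex.exp (2 * Real.pi * Complex.I * z.re)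

/-- The Kloosterman sum `S(m, n; c)` over the Gaussian integers: the sum over invertible
residues `α` modulo `c` (with `δ` the inverse residue) of `e[(αm + δn)/c]`. -/
noncomputable def kloosterman (m n c : GaussianInt) : ℂ :=
  ∑ᶠ u : (GaussianInt ⧸ Ideal.span {c})ˣ,
    efn (((Quotient.out (u : GaussianInt ⧸ Ideal.span {c}) : GaussianInt) * m +
          (Quotient.out ((u⁻¹ : (GaussianInt ⧸ Ideal.span {c})ˣ) :
              GaussianInt ⧸ Ideal.span {c}) : GaussianInt) * n : GaussianInt) / (c : ℂ))

/-- `n` is the distinguished generator of its ideal: nonzero with argument in `[0, π/2)`. -/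
def IsGen (n : GaussianInt) : Prop :=
  n ≠ 0 ∧ 0 ≤ Complex.arg (n : ℂ) ∧ Complex.arg (n : ℂ) < Real.pi / 2

/-- distinguished generator in the annulus `N < |n| ≤ √2·N`. -/
def InAnn (N : ℝ) (n : GaussianInt) : Prop :=
  IsGen n ∧ N < ‖(n : ℂ)‖ ∧ ‖(n : ℂ)‖ ≤ Real.sqrt 2 * N

/-- `‖b_N‖₂² = Σ_{N < |n| ≤ √2 N} |b_n|²`, over distinguished generators. -/
noncomputable def sqNorm (b : GaussianInt → ℂ) (N : ℝ) : ℝ :=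
  ∑ᶠ n ∈ {n : GaussianInt | InAnn N n}, ‖b n‖ ^ 2

/-- The quadratic form
`B(θ,c,N) = Σ_m Σ_n b_m conj(b_n) S(m,n;c) cos(4π Re(√(mn) θ / c))`. -/
noncomputable def Bform (b : GaussianInt → ℂ) (θ : ℂ) (c : GaussianInt) (N : ℝ) : ℂ :=
  ∑ᶠ m ∈ {m : GaussianInt | InAnn N m}, ∑ᶠ n ∈ {n : GaussianInt | InAnn N n},
    b m * conj (b n) * kloosterman m n c *
      Real.cos (4 * Real.pi * ((((m : ℂ) * (n : ℂ)) ^ ((1:ℂ)/2) * θ / (c : ℂ)).re))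

/-- `R` bounds the bilinear form with kernel `K` on the finite set `A`. -/
def OpBound {ι : Type*} (A : Finset ι) (K : ι → ι → ℂ) (R : ℝ) : Prop :=
  ∀ a b : ι → ℂ, ‖∑ m ∈ A, ∑ n ∈ A, a m * b n * K m n‖ ≤
    R * (Real.sqrt (∑ m ∈ A, ‖a m‖ ^ 2) * Real.sqrt (∑ n ∈ A, ‖b n‖ ^ 2))

lemma sqrt_sum_mul_pow_le {ι : Type*} (A : Finset ι) (a u : ι → ℂ) (U : ℝ) (hU0 : 0 ≤ U)
    (hU : ∀ m ∈ A, ‖u m‖ ≤ U) (k : ℕ) :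
    Real.sqrt (∑ m ∈ A, ‖a m * u m ^ k‖ ^ 2) ≤ U ^ k * Real.sqrt (∑ m ∈ A, ‖a m‖ ^ 2) := by
  rw [Real.sqrt_le_left (by positivity), mul_pow, Real.sq_sqrt (by positivity), Finset.mul_sum]
  refine Finset.sum_le_sum fun m hm => ?_
  rw [norm_mul, norm_pow, mul_pow, mul_comm]
  have := hU m hm
  gcongr

/-- Schur multiplication by `exp (u m * v n)`. -/
lemma OpBound.exp_mul {ι : Type*} {A : Finset ι} {K : ι → ι → ℂ} {R : ℝ} (h : OpBound A K R)
    (hR : 0 ≤ R) (u v : ι → ℂ) (U V : ℝ) (hU0 : 0 ≤ U) (hV0 : 0 ≤ V)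
    (hU : ∀ m ∈ A, ‖u m‖ ≤ U) (hV : ∀ m ∈ A, ‖v m‖ ≤ V) :
    OpBound A (fun m n => K m n * Complex.exp (u m * v n)) (R * Real.exp (U * V)) := by
  intro a b
  set P := Real.sqrt (∑ m ∈ A, ‖a m‖ ^ 2)
  set Q := Real.sqrt (∑ m ∈ A, ‖b m‖ ^ 2)
  have h1 : HasSum (fun k : ℕ => ∑ m ∈ A, ∑ n ∈ A,
      a m * b n * (K m n * ((u m * v n) ^ k / (k.factorial : ℂ))))
      (∑ m ∈ A, ∑ n ∈ A, a m * b n * (K m n * Complex.exp (u m * v n))) := by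
    refine hasSum_sum fun m _ => hasSum_sum fun n _ => ?_
    have := NormedSpace.expSeries_div_hasSum_exp (𝔸 := ℂ) (u m * v n)
    rw [← Complex.exp_eq_exp_ℂ] at this
    exact (this.mul_left _).mul_left _
  have h2 : HasSum (fun k : ℕ => (R * (P * Q)) * ((U * V) ^ k / (k.factorial : ℝ)))
      ((R * (P * Q)) * Real.exp (U * V)) := by
    have := NormedSpace.expSeries_div_hasSum_exp (𝔸 := ℝ) (U * V)
    rw [← Real.exp_eq_exp_ℝ] at this
    exact this.mul_left _
  have h3 := h1.norm_le_of_bounded h2 ?_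
  · refine h3.trans (le_of_eq ?_)
    ring
  intro k
  have h4 := h (fun m => a m * u m ^ k) (fun n => b n * v n ^ k)
  have h5 : (∑ m ∈ A, ∑ n ∈ A, a m * b n * (K m n * ((u m * v n) ^ k / (k.factorial : ℂ))))
      = (∑ m ∈ A, ∑ n ∈ A, (a m * u m ^ k) * (b n * v n ^ k) * K m n) / (k.factorial : ℂ) := by
    rw [Finset.sum_div]
    refine Finset.sum_congr rfl fun m _ => ?_
    rw [Finset.sum_div]
    refine Finset.sum_congr rfl fun n _ => ?_
    rw [mul_pow]; ring
  rw [h5, norm_div, Complex.norm_natCast]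
  have hk : (0:ℝ) < k.factorial := by positivity
  rw [← mul_div_assoc]
  gcongr
  refine h4.trans ?_
  have e1 := sqrt_sum_mul_pow_le A a u U hU0 hU k
  have e2 := sqrt_sum_mul_pow_le A b v V hV0 hV k
  calc _ ≤ R * ((U ^ k * P) * (V ^ k * Q)) := by gcongr
    _ = _ := by rw [mul_pow]; ring

/-- Plancherel for an orthogonal kernel. -/
lemma orth_sum {I J : Type*} [Fintype I] [Fintype J] [DecidableEq J] (Φ : I → J → ℂ) (T : ℝ)
    (hΦ : ∀ j j', ∑ i, Φ i j * conj (Φ i j') = if j = j' then (T : ℂ) else 0) (z : J → ℂ) :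
    ∑ i, ‖∑ j, z j * Φ i j‖ ^ 2 = T * ∑ j, ‖z j‖ ^ 2 := by
  have key : ((∑ i, ‖∑ j, z j * Φ i j‖ ^ 2 : ℝ) : ℂ) = ((T * ∑ j, ‖z j‖ ^ 2 : ℝ) : ℂ) := by
    push_cast
    have : ∀ i, ((‖∑ j, z j * Φ i j‖ : ℂ)) ^ 2
        = ∑ j, ∑ j', z j * conj (z j') * (Φ i j * conj (Φ i j')) := by
      intro i
      rw [← Complex.mul_conj', map_sum, Finset.sum_mul_sum]
      refine Finset.sum_congr rfl fun j _ => Finset.sum_congr rfl fun j' _ => ?_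
      rw [map_mul]; ring
    simp_rw [this]
    rw [Finset.sum_comm]
    rw [Finset.mul_sum]
    refine Finset.sum_congr rfl fun j _ => ?_
    rw [Finset.sum_comm]
    simp_rw [← Finset.mul_sum, hΦ]
    simp only [mul_ite, mul_zero, Finset.sum_ite_eq, Finset.mem_univ, if_true]
    rw [Complex.mul_conj']; ring
  exact_mod_cast key

lemma orth_sum_fiber {ι I J : Type*} [Fintype I] [Fintype J] [DecidableEq J] (Φ : I → J → ℂ)
    (T : ℝ) (hT : 0 ≤ T)
    (hΦ : ∀ j j', ∑ i, Φ i j * conj (Φ i j') = if j = j' then (T : ℂ) else 0)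
    (A : Finset ι) (f : ι → J) (M : ℝ)
    (hM : ∀ j, ((A.filter (fun m => f m = j)).card : ℝ) ≤ M) (a : ι → ℂ) :
    ∑ i, ‖∑ m ∈ A, a m * Φ i (f m)‖ ^ 2 ≤ T * M * ∑ m ∈ A, ‖a m‖ ^ 2 := by
  have h1 : ∀ i, ∑ m ∈ A, a m * Φ i (f m)
      = ∑ j, (∑ m ∈ A.filter (fun m => f m = j), a m) * Φ i j := by
    intro i
    rw [← Finset.sum_fiberwise A f]
    refine Finset.sum_congr rfl fun j _ => ?_
    rw [Finset.sum_mul]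
    refine Finset.sum_congr rfl fun m hm => ?_
    rw [(Finset.mem_filter.1 hm).2]
  simp_rw [h1]
  rw [orth_sum Φ T hΦ, mul_assoc]
  refine mul_le_mul_of_nonneg_left ?_ hT
  rw [← Finset.sum_fiberwise A f, Finset.mul_sum]
  refine Finset.sum_le_sum fun j _ => ?_
  calc ‖∑ m ∈ A.filter (fun m => f m = j), a m‖ ^ 2
      ≤ (∑ m ∈ A.filter (fun m => f m = j), ‖a m‖) ^ 2 := by
        gcongr; exact norm_sum_le _ _
    _ ≤ ((A.filter (fun m => f m = j)).card : ℝ) * ∑ m ∈ A.filter (fun m => f m = j), ‖a m‖ ^ 2 :=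
        sq_sum_le_card_mul_sum_sq
    _ ≤ _ := by
        gcongr
        exact hM j

lemma addChar_orth {R : Type*} [CommRing R] [Fintype R] [DecidableEq R] (ψ : AddChar R ℂ)
    (hψ : ψ.IsPrimitive) (j j' : R) :
    ∑ i, ψ (i * j) * conj (ψ (i * j')) = if j = j' then ((Fintype.card R : ℝ) : ℂ) else 0 := by
  have h : ∀ i, ψ (i * j) * conj (ψ (i * j')) = ψ (i * (j - j')) := by
    intro i
    rw [← AddChar.map_neg_eq_conj, ← AddChar.map_add_eq_mul]
    congr 1; ring
  simp_rw [h]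
  rw [AddChar.sum_mulShift _ hψ]
  simp [sub_eq_zero]

lemma orth_prod {I J I' J' : Type*} [Fintype I] [Fintype I'] [DecidableEq J] [DecidableEq J']
    (Φ : I → J → ℂ) (Φ' : I' → J' → ℂ) (T T' : ℝ)
    (hΦ : ∀ j j', ∑ i, Φ i j * conj (Φ i j') = if j = j' then (T : ℂ) else 0)
    (hΦ' : ∀ j j', ∑ i, Φ' i j * conj (Φ' i j') = if j = j' then (T' : ℂ) else 0)
    (j j' : J × J') :
    ∑ i : I × I', (Φ i.1 j.1 * Φ' i.2 j.2) * conj (Φ i.1 j'.1 * Φ' i.2 j'.2)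
      = if j = j' then ((T * T' : ℝ) : ℂ) else 0 := by
  rw [Fintype.sum_prod_type]
  have : ∀ x : I, ∑ y : I', (Φ x j.1 * Φ' y j.2) * conj (Φ x j'.1 * Φ' y j'.2)
      = (Φ x j.1 * conj (Φ x j'.1)) * ∑ y : I', Φ' y j.2 * conj (Φ' y j'.2) := by
    intro x
    rw [Finset.mul_sum]
    refine Finset.sum_congr rfl fun y _ => ?_
    rw [map_mul]; ring
  simp only [this]
  rw [← Finset.sum_mul, hΦ, hΦ']
  by_cases h1 : j.1 = j'.1 <;> by_cases h2 : j.2 = j'.2 <;> simp [h1, h2, Prod.ext_iff]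

/-- The discrete double large sieve. -/
lemma opBound_discrete {ι R S : Type*} [CommRing R] [Fintype R] [DecidableEq R]
    [Fintype S] [DecidableEq S] (ψ : AddChar R ℂ) (hψ : ψ.IsPrimitive)
    (F : S → S → ℂ) (T : ℝ) (hT : 0 ≤ T)
    (hF : ∀ j j', ∑ i, F i j * conj (F i j') = if j = j' then ((T ^ 2 : ℝ) : ℂ) else 0)
    (A : Finset ι) (g : ι → R) (p : ι → S) (M : ℝ) (hM0 : 0 ≤ M)
    (hM : ∀ j, ((A.filter (fun m => (g m, p m) = j)).card : ℝ) ≤ M) :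
    OpBound A (fun m n => (∑ u : Rˣ, ψ ((u : R) * g m + ((u⁻¹ : Rˣ) : R) * g n)) * F (p n) (p m))
      (Fintype.card R * T * M) := by
  intro a b
  set f : ι → R × S := fun m => (g m, p m) with hf
  -- the two factors
  set X : R × S → ℂ := fun i => ∑ m ∈ A, a m * (ψ (i.1 * (f m).1) * F i.2 (f m).2) with hX
  set Y : R × S → ℂ := fun i => ∑ n ∈ A, b n * (ψ (i.1 * (f n).1) *
    (if i.2 = (f n).2 then (1:ℂ) else 0)) with hY
  have hXb : ∑ i, ‖X i‖ ^ 2 ≤ (Fintype.card R * T ^ 2) * M * ∑ m ∈ A, ‖a m‖ ^ 2 :=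
    orth_sum_fiber (fun (i : R × S) (j : R × S) => ψ (i.1 * j.1) * F i.2 j.2) _ (by positivity)
      (orth_prod (fun i j => ψ (i * j)) F _ _ (addChar_orth ψ hψ) hF) A f M hM a
  have hid : ∀ j j' : S, ∑ i : S, (if i = j then (1:ℂ) else 0) * conj (if i = j' then (1:ℂ) else 0)
      = if j = j' then ((1:ℝ) : ℂ) else 0 := by
    intro j j'
    simp [eq_comm]
  have hYb : ∑ i, ‖Y i‖ ^ 2 ≤ (Fintype.card R * 1) * M * ∑ m ∈ A, ‖b m‖ ^ 2 :=
    orth_sum_fiber (fun (i : R × S) (j : R × S) => ψ (i.1 * j.1) * (if i.2 = j.2 then (1:ℂ) else 0))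
      _ (by positivity)
      (orth_prod (fun i j => ψ (i * j)) (fun i j => if i = j then (1:ℂ) else 0) _ _
        (addChar_orth ψ hψ) hid) A f M hM b
  have hmain : ∑ m ∈ A, ∑ n ∈ A, a m * b n *
      ((∑ u : Rˣ, ψ ((u : R) * g m + ((u⁻¹ : Rˣ) : R) * g n)) * F (p n) (p m))
      = ∑ i : Rˣ × S, X ((i.1 : R), i.2) * Y (((i.1⁻¹ : Rˣ) : R), i.2) := by
    simp only [hX, hY, Finset.sum_mul_sum]
    conv_rhs => rw [Finset.sum_comm]
    refine Finset.sum_congr rfl fun m _ => ?_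
    conv_rhs => rw [Finset.sum_comm]
    refine Finset.sum_congr rfl fun n _ => ?_
    rw [Fintype.sum_prod_type, Finset.sum_mul, Finset.mul_sum]
    refine Finset.sum_congr rfl fun u _ => ?_
    rw [Finset.sum_eq_single (p n)]
    · simp only [hf, AddChar.map_add_eq_mul, if_true]
      ring
    · intro s _ hs
      simp [hf, hs]
    · simp
  have hXu : ∑ i : Rˣ × S, ‖X ((i.1 : R), i.2)‖ ^ 2 ≤ ∑ i, ‖X i‖ ^ 2 := by
    have hinj : Function.Injective (fun i : Rˣ × S => (((i.1 : R), i.2) : R × S)) := by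
      rintro ⟨u, s⟩ ⟨u', s'⟩ h
      simp only [Prod.mk.injEq] at h
      rw [Units.ext h.1, h.2]
    refine (Finset.sum_map Finset.univ ⟨_, hinj⟩ (fun i => ‖X i‖ ^ 2)).symm.le.trans ?_
    exact Finset.sum_le_sum_of_subset_of_nonneg (Finset.subset_univ _) (fun _ _ _ => by positivity)
  have hYu : ∑ i : Rˣ × S, ‖Y (((i.1⁻¹ : Rˣ) : R), i.2)‖ ^ 2 ≤ ∑ i, ‖Y i‖ ^ 2 := by
    have hinj : Function.Injective (fun i : Rˣ × S => ((((i.1⁻¹ : Rˣ) : R), i.2) : R × S)) := by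
      rintro ⟨u, s⟩ ⟨u', s'⟩ h
      simp only [Prod.mk.injEq] at h
      rw [inv_injective (Units.ext h.1), h.2]
    refine (Finset.sum_map Finset.univ ⟨_, hinj⟩ (fun i => ‖Y i‖ ^ 2)).symm.le.trans ?_
    exact Finset.sum_le_sum_of_subset_of_nonneg (Finset.subset_univ _) (fun _ _ _ => by positivity)
  rw [hmain]
  have hc : (0:ℝ) ≤ Fintype.card R := by positivity
  calc _ ≤ ∑ i : Rˣ × S, ‖X ((i.1 : R), i.2)‖ * ‖Y (((i.1⁻¹ : Rˣ) : R), i.2)‖ := by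
        refine (norm_sum_le _ _).trans (le_of_eq ?_)
        simp_rw [norm_mul]
    _ ≤ Real.sqrt (∑ i : Rˣ × S, ‖X ((i.1 : R), i.2)‖ ^ 2) *
          Real.sqrt (∑ i : Rˣ × S, ‖Y (((i.1⁻¹ : Rˣ) : R), i.2)‖ ^ 2) :=
        Real.sum_mul_le_sqrt_mul_sqrt _ _ _
    _ ≤ Real.sqrt ((Fintype.card R * T ^ 2) * M * ∑ m ∈ A, ‖a m‖ ^ 2) *
          Real.sqrt ((Fintype.card R * 1) * M * ∑ m ∈ A, ‖b m‖ ^ 2) := by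
        gcongr
        · exact hXu.trans hXb
        · exact hYu.trans hYb
    _ = Real.sqrt ((Fintype.card R * T * M) ^ 2 * ((∑ m ∈ A, ‖a m‖ ^ 2) * (∑ m ∈ A, ‖b m‖ ^ 2))) := by
        rw [← Real.sqrt_mul (by positivity)]
        congr 1; ring
    _ = _ := by
        rw [Real.sqrt_mul (by positivity), Real.sqrt_sq (by positivity),
          Real.sqrt_mul (by positivity)]

/-- One coordinate of the grid decomposition. -/
lemma OpBound.grid1 {ι : Type*} {A : Finset ι} {K : ι → ι → ℂ} {R : ℝ} (δ D X : ℝ) (s : ℝ)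
    (hs : |s| = 1)
    (y : ι → ℝ) (k : ι → ℤ) (hδ : 0 < δ) (hδ1 : δ ≤ 1) (hX : 0 ≤ X) (hXδ : X * δ ≤ 1)
    (hD : 2 * δ ^ 2 * D = 1)
    (hy : ∀ m ∈ A, |y m| ≤ X) (hk : ∀ m ∈ A, |y m - δ * k m| ≤ δ)
    (h : OpBound A (fun m n => K m n * Complex.exp (2 * Real.pi * I * (s * (k m * k n)) / D)) R)
    (hR : 0 ≤ R) :
    OpBound A (fun m n => K m n * Complex.exp (4 * Real.pi * I * (s * (y m * y n))))
      (R * Real.exp (4 * Real.pi * 1) * Real.exp (4 * Real.pi * 2)) := by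
  have h1 := h.exp_mul hR (fun m => 4 * Real.pi * I * s * y m) (fun n => ((y n - δ * k n : ℝ) : ℂ))
    (4 * Real.pi * X) δ (by positivity) hδ.le
    (fun m hm => by
      simp only [norm_mul, Complex.norm_I, Complex.norm_real, Complex.norm_ofNat, Real.norm_eq_abs,
        hs, abs_of_pos Real.pi_pos, mul_one]
      have := hy m hm
      gcongr)
    (fun m hm => by rw [Complex.norm_real, Real.norm_eq_abs]; exact hk m hm)
  have h2 := h1.exp_mul (by positivity) (fun m => ((y m - δ * k m : ℝ) : ℂ))
    (fun n => 4 * Real.pi * I * s * (δ * k n)) δ (4 * Real.pi * (X + δ)) hδ.le (by positivity)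
    (fun m hm => by rw [Complex.norm_real, Real.norm_eq_abs]; exact hk m hm)
    (fun m hm => by
      rw [← Complex.ofReal_intCast, ← Complex.ofReal_mul]
      simp only [norm_mul, Complex.norm_I, Complex.norm_real, Complex.norm_ofNat, Real.norm_eq_abs,
        hs, abs_of_pos Real.pi_pos, mul_one]
      have h3 := hy m hm
      have h4 := hk m hm
      have : |δ * (k m : ℝ)| ≤ X + δ := by
        rw [abs_le] at *; constructor <;> linarith
      rw [abs_mul] at this
      gcongr)
  intro a b
  have h3 := h2 a b
  refine le_trans (le_of_eq ?_) (h3.trans ?_)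
  · congr 1
    refine Finset.sum_congr rfl fun m _ => Finset.sum_congr rfl fun n _ => ?_
    beta_reduce
    rw [mul_assoc (K m n), mul_assoc (K m n), ← Complex.exp_add, ← Complex.exp_add]
    congr 3
    have hDc : (2 * (δ:ℂ) ^ 2 * D) = 1 := by exact_mod_cast hD
    have hD0 : (D:ℂ) ≠ 0 := by
      rintro h0; rw [h0] at hDc; simp at hDc
    have : (2 * Real.pi * I * (s * (k m * k n)) / D : ℂ)
        = 4 * Real.pi * I * s * (k m * k n) * δ ^ 2 := by
      rw [div_eq_iff hD0]
      linear_combination (-(2 * Real.pi * I * (s * (k m * k n)) : ℂ)) * hDc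
    rw [this]
    push_cast
    ring
  · have e1 : 4 * Real.pi * X * δ ≤ 4 * Real.pi * 1 := by
      rw [mul_assoc]; gcongr
    have e2 : δ * (4 * Real.pi * (X + δ)) ≤ 4 * Real.pi * 2 := by
      have : δ * (X + δ) ≤ 2 := by nlinarith
      calc _ = 4 * Real.pi * (δ * (X + δ)) := by ring
        _ ≤ _ := by gcongr
    gcongr

/-- The two-dimensional grid decomposition. -/
lemma OpBound.grid2 {ι : Type*} {A : Finset ι} {K : ι → ι → ℂ} {R : ℝ} (δ X : ℝ)
    (D : ℕ) [NeZero D]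
    (y : ι → ℂ) (k l : ι → ℤ) (hδ : 0 < δ) (hδ1 : δ ≤ 1) (hX : 0 ≤ X) (hXδ : X * δ ≤ 1)
    (hD : 2 * δ ^ 2 * D = 1)
    (hy : ∀ m ∈ A, ‖y m‖ ≤ X) (hk : ∀ m ∈ A, |(y m).re - δ * k m| ≤ δ)
    (hl : ∀ m ∈ A, |(y m).im - δ * l m| ≤ δ)
    (h : OpBound A (fun m n => K m n * (ZMod.stdAddChar ((k n : ZMod D) * (k m : ZMod D)) *
      conj (ZMod.stdAddChar ((l n : ZMod D) * (l m : ZMod D))))) R)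
    (hR : 0 ≤ R) :
    OpBound A (fun m n => K m n * Complex.exp (4 * Real.pi * I * (y m * y n).re))
      (R * Real.exp (24 * Real.pi)) := by
  have h0 : OpBound A (fun m n => (K m n *
      Complex.exp (2 * Real.pi * I * (((-1:ℝ):ℂ) * (l m * l n)) / (D:ℝ))) *
      Complex.exp (2 * Real.pi * I * (((1:ℝ):ℂ) * (k m * k n)) / (D:ℝ))) R := by
    convert h using 3 with m n
    have hk1 : (ZMod.stdAddChar ((k n : ZMod D) * (k m : ZMod D)) : ℂ)
        = Complex.exp (2 * Real.pi * I * (((1:ℝ):ℂ) * (k m * k n)) / (D:ℝ)) := by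
      rw [← Int.cast_mul, ZMod.stdAddChar_coe]
      congr 1; push_cast; ring
    have hl1 : conj (ZMod.stdAddChar ((l n : ZMod D) * (l m : ZMod D)) : ℂ)
        = Complex.exp (2 * Real.pi * I * (((-1:ℝ):ℂ) * (l m * l n)) / (D:ℝ)) := by
      rw [← AddChar.map_neg_eq_conj, ← Int.cast_mul, ← Int.cast_neg, ZMod.stdAddChar_coe]
      congr 1; push_cast; ring
    rw [hk1, hl1]; ring
  have h1 := h0.grid1 δ D X 1 (by simp) (fun m => (y m).re) k hδ hδ1 hX hXδ hD
    (fun m hm => (Complex.abs_re_le_norm _).trans (hy m hm)) hk hR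
  have h1' : OpBound A (fun m n => (K m n *
      Complex.exp (4 * Real.pi * I * (((1:ℝ):ℂ) * ((y m).re * (y n).re)))) *
      Complex.exp (2 * Real.pi * I * (((-1:ℝ):ℂ) * (l m * l n)) / (D:ℝ))) (R * Real.exp (4 * Real.pi * 1) * Real.exp (4 * Real.pi * 2)) := by
    convert h1 using 3 with m n
    ring
  have h2 := h1'.grid1 δ D X (-1) (by simp) (fun m => (y m).im) l hδ hδ1 hX hXδ hD
    (fun m hm => (Complex.abs_im_le_norm _).trans (hy m hm)) hl (by positivity)
  convert h2 using 1
  · funext m n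
    rw [mul_assoc (K m n), ← Complex.exp_add]
    congr 2
    rw [Complex.mul_re]
    push_cast
    ring
  · rw [mul_assoc R, mul_assoc R, mul_assoc R, ← Real.exp_add, ← Real.exp_add, ← Real.exp_add]
    congr 2; ring

lemma zmod_grid_orth (D : ℕ) [NeZero D] (j j' : ZMod D × ZMod D) :
    ∑ i : ZMod D × ZMod D, (ZMod.stdAddChar (i.1 * j.1) * conj (ZMod.stdAddChar (i.2 * j.2))) *
      conj (ZMod.stdAddChar (i.1 * j'.1) * conj (ZMod.stdAddChar (i.2 * j'.2)))
      = if j = j' then (((D : ℝ) ^ 2 : ℝ) : ℂ) else 0 := by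
  have hc : ∀ j j' : ZMod D, ∑ i : ZMod D, conj (ZMod.stdAddChar (i * j) : ℂ) *
      conj (conj (ZMod.stdAddChar (i * j') : ℂ)) = if j = j' then ((D : ℝ) : ℂ) else 0 := by
    intro j j'
    have h2 := congrArg conj (addChar_orth _ (ZMod.isPrimitive_stdAddChar D) j j')
    rw [map_sum] at h2
    simp only [map_mul] at h2
    rw [h2, ZMod.card]
    split_ifs <;> simp
  have h := orth_prod (fun i j : ZMod D => (ZMod.stdAddChar (i * j) : ℂ))
    (fun i j : ZMod D => conj (ZMod.stdAddChar (i * j) : ℂ)) _ _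
    (addChar_orth _ (ZMod.isPrimitive_stdAddChar D)) hc j j'
  rw [ZMod.card] at h
  rw [pow_two]
  exact h

/-- Counting Gaussian integers in a disc. -/
lemma card_gauss_le (F : Finset GaussianInt) (ρ : ℝ) (hρ : 0 ≤ ρ)
    (h : ∀ z ∈ F, ‖(z : ℂ)‖ ≤ ρ) : (F.card : ℝ) ≤ (2 * ρ + 1) ^ 2 := by
  set J : Finset ℤ := Finset.Icc (-⌊ρ⌋) ⌊ρ⌋ with hJ
  have hJc : (J.card : ℝ) ≤ 2 * ρ + 1 := by
    have h0 : 0 ≤ ⌊ρ⌋ := Int.floor_nonneg.2 hρ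
    have h1 : (J.card : ℤ) = 2 * ⌊ρ⌋ + 1 := by
      rw [hJ, Int.card_Icc, Int.toNat_of_nonneg (by omega)]; ring
    have h2 : (J.card : ℝ) = 2 * (⌊ρ⌋ : ℝ) + 1 := by exact_mod_cast h1
    rw [h2]
    linarith [Int.floor_le ρ]
  have hmem : ∀ x : ℤ, |(x : ℝ)| ≤ ρ → x ∈ J := by
    intro x hx
    rw [abs_le] at hx
    rw [hJ, Finset.mem_Icc]
    refine ⟨?_, Int.le_floor.2 hx.2⟩
    have : -x ≤ ⌊ρ⌋ := Int.le_floor.2 (by push_cast; linarith)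
    omega
  have hle : F.card ≤ (J ×ˢ J).card := by
    refine Finset.card_le_card_of_injOn (fun z => (z.re, z.im)) ?_ ?_
    · intro z hz
      have hz := h z hz
      simp only [Finset.coe_product, Set.mem_prod, Finset.mem_coe]
      refine ⟨hmem _ ?_, hmem _ ?_⟩
      · rw [GaussianInt.intCast_re]; exact (Complex.abs_re_le_norm _).trans hz
      · rw [GaussianInt.intCast_im]; exact (Complex.abs_im_le_norm _).trans hz
    · intro z _ z' _ hzz
      simp only [Prod.mk.injEq] at hzz
      exact Zsqrtd.ext hzz.1 hzz.2
  rw [Finset.card_product] at hle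
  calc (F.card : ℝ) ≤ (J.card : ℝ) * J.card := by exact_mod_cast hle
    _ ≤ (2 * ρ + 1) * (2 * ρ + 1) := by gcongr
    _ = _ := by ring

lemma finite_gauss (ρ : ℝ) : {z : GaussianInt | ‖(z : ℂ)‖ ≤ ρ}.Finite := by
  by_contra hinf
  obtain ⟨F, hF, hc⟩ := Set.Infinite.exists_subset_card_eq hinf (⌈(2 * |ρ| + 1) ^ 2⌉₊ + 1)
  have := card_gauss_le F |ρ| (abs_nonneg _) (fun z hz => (hF hz).trans (le_abs_self _))
  rw [hc] at this
  push_cast at this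
  linarith [Nat.le_ceil ((2 * |ρ| + 1) ^ 2)]

lemma efn_add (z w : ℂ) : efn (z + w) = efn z * efn w := by
  rw [efn, efn, efn, ← Complex.exp_add]
  congr 1
  rw [Complex.add_re]; push_cast; ring

lemma efn_gauss (z : GaussianInt) : efn (z : ℂ) = 1 := by
  rw [efn, Complex.exp_eq_one_iff]
  refine ⟨z.re, ?_⟩
  rw [← GaussianInt.intCast_re]
  push_cast; ring

lemma efn_eq_one {z : ℂ} (h : efn z = 1) : ∃ k : ℤ, z.re = k := by
  rw [efn, Complex.exp_eq_one_iff] at h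
  obtain ⟨k, hk⟩ := h
  refine ⟨k, ?_⟩
  have hpi : (2 * Real.pi * I : ℂ) ≠ 0 := Complex.two_pi_I_ne_zero
  have : (2 * Real.pi * I : ℂ) * (z.re : ℂ) = (2 * Real.pi * I : ℂ) * (k : ℂ) := by
    rw [hk]; ring
  exact_mod_cast mul_left_cancel₀ hpi this

lemma norm_gauss_one_le {c : GaussianInt} (hc : c ≠ 0) : 1 ≤ ‖(c : ℂ)‖ := by
  have h1 : 1 ≤ Zsqrtd.norm c := GaussianInt.norm_pos.2 hc
  have h2 : (1:ℝ) ≤ (Zsqrtd.norm c : ℝ) := by exact_mod_cast h1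
  rw [GaussianInt.intCast_real_norm, Complex.normSq_eq_norm_sq] at h2
  nlinarith [norm_nonneg (c : ℂ)]

lemma mk_eq_efn (c : GaussianInt) (hc : c ≠ 0) (x y : GaussianInt)
    (h : Ideal.Quotient.mk (Ideal.span {c}) x = Ideal.Quotient.mk (Ideal.span {c}) y) :
    efn ((x : ℂ) / c) = efn ((y : ℂ) / c) := by
  rw [Ideal.Quotient.mk_eq_mk_iff_sub_mem, Ideal.mem_span_singleton] at h
  obtain ⟨k, hk⟩ := h
  have hc' : (c : ℂ) ≠ 0 := by rwa [Ne, GaussianInt.toComplex_eq_zero]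
  have : (x : ℂ) / c = (y : ℂ) / c + k := by
    have h1 : x = y + c * k := by rw [← hk]; ring
    rw [h1, GaussianInt.toComplex_add, GaussianInt.toComplex_mul]
    field_simp
  rw [this, efn_add, efn_gauss, mul_one]

lemma mk_out (c : GaussianInt) (α : GaussianInt ⧸ Ideal.span {c}) :
    Ideal.Quotient.mk (Ideal.span {c}) (Quotient.out α) = α := Quotient.out_eq α

/-- The additive character `z ↦ e[z/c]` of `O/c`. -/
noncomputable def gaussChar (c : GaussianInt) (hc : c ≠ 0) :
    AddChar (GaussianInt ⧸ Ideal.span {c}) ℂ where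
  toFun α := efn (((Quotient.out α : GaussianInt) : ℂ) / c)
  map_zero_eq_one' := by
    rw [mk_eq_efn c hc _ 0 (by rw [mk_out, map_zero])]
    simp [efn]
  map_add_eq_mul' α β := by
    rw [← efn_add, ← add_div, ← GaussianInt.toComplex_add]
    exact mk_eq_efn c hc _ _ (by rw [map_add, mk_out, mk_out, mk_out])

lemma gaussChar_mk (c : GaussianInt) (hc : c ≠ 0) (x : GaussianInt) :
    gaussChar c hc (Ideal.Quotient.mk _ x) = efn ((x : ℂ) / c) :=
  mk_eq_efn c hc _ _ (mk_out _ _)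

lemma gaussChar_primitive (c : GaussianInt) (hc : c ≠ 0) : (gaussChar c hc).IsPrimitive := by
  intro a ha h
  apply ha
  obtain ⟨x, rfl⟩ := Ideal.Quotient.mk_surjective a
  have hx : ∀ y : GaussianInt, efn (((x * y : GaussianInt) : ℂ) / c) = 1 := by
    intro y
    have := DFunLike.congr_fun h (Ideal.Quotient.mk _ y)
    rw [AddChar.mulShift_apply, ← map_mul, gaussChar_mk] at this
    simpa using this
  have hc' : (c : ℂ) ≠ 0 := by rwa [Ne, GaussianInt.toComplex_eq_zero]
  obtain ⟨k, hk⟩ := efn_eq_one (hx 1)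
  obtain ⟨l, hl⟩ := efn_eq_one (hx ⟨0, -1⟩)
  rw [Ideal.Quotient.eq_zero_iff_mem, Ideal.mem_span_singleton]
  refine ⟨⟨k, l⟩, ?_⟩
  rw [← GaussianInt.toComplex_inj, GaussianInt.toComplex_mul, mul_comm, ← div_eq_iff hc']
  rw [mul_one] at hk
  rw [GaussianInt.toComplex_mul, mul_comm, mul_div_assoc] at hl
  apply Complex.ext
  · rw [hk, GaussianInt.re_toComplex]
  · rw [GaussianInt.im_toComplex, ← hl, GaussianInt.toComplex_def', Complex.mul_re]
    simp

lemma quot_finite_card (c : GaussianInt) (hc : c ≠ 0) :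
    ∃ _ : Fintype (GaussianInt ⧸ Ideal.span {c}),
      (Fintype.card (GaussianInt ⧸ Ideal.span {c}) : ℝ) ≤ 9 * ‖(c : ℂ)‖ ^ 2 := by
  classical
  set F := (finite_gauss ‖(c : ℂ)‖).toFinset with hF
  have hsurj : ∀ α : GaussianInt ⧸ Ideal.span {c}, ∃ z ∈ F, Ideal.Quotient.mk _ z = α := by
    intro α
    obtain ⟨x, rfl⟩ := Ideal.Quotient.mk_surjective α
    refine ⟨x % c, ?_, ?_⟩
    · rw [hF, Set.Finite.mem_toFinset, Set.mem_ofPred_eq]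
      have h1 := GaussianInt.norm_mod_lt x hc
      have h2 : (Zsqrtd.norm (x % c) : ℝ) ≤ (Zsqrtd.norm c : ℝ) := by exact_mod_cast h1.le
      rw [GaussianInt.intCast_real_norm, GaussianInt.intCast_real_norm,
        Complex.normSq_eq_norm_sq, Complex.normSq_eq_norm_sq] at h2
      exact le_of_sq_le_sq h2 (norm_nonneg _)
    · rw [Ideal.Quotient.mk_eq_mk_iff_sub_mem, Ideal.mem_span_singleton, GaussianInt.mod_def]
      exact ⟨-(x / c), by ring⟩
  have hfin : Finite (GaussianInt ⧸ Ideal.span {c}) := by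
    refine Finite.of_surjective (fun z : F => Ideal.Quotient.mk (Ideal.span {c}) z.1) ?_
    intro α
    obtain ⟨z, hz, h⟩ := hsurj α
    exact ⟨⟨z, hz⟩, h⟩
  refine ⟨Fintype.ofFinite _, ?_⟩
  let _ := Fintype.ofFinite (GaussianInt ⧸ Ideal.span {c})
  have h1 : Fintype.card (GaussianInt ⧸ Ideal.span {c}) ≤ F.card := by
    rw [← Fintype.card_coe F]
    refine Fintype.card_le_of_surjective (fun z : F => Ideal.Quotient.mk (Ideal.span {c}) z.1) ?_
    intro α
    obtain ⟨z, hz, h⟩ := hsurj α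
    exact ⟨⟨z, hz⟩, h⟩
  have h2 := card_gauss_le F ‖(c : ℂ)‖ (norm_nonneg _) (fun z hz => by
    rw [hF, Set.Finite.mem_toFinset] at hz; exact hz)
  have h3 := norm_gauss_one_le hc
  have h4 : (Fintype.card (GaussianInt ⧸ Ideal.span {c}) : ℝ) ≤ F.card := by exact_mod_cast h1
  nlinarith

lemma kloosterman_eq (c : GaussianInt) (hc : c ≠ 0) [Fintype (GaussianInt ⧸ Ideal.span {c})]
    [DecidableEq (GaussianInt ⧸ Ideal.span {c})] (m n : GaussianInt) :
    kloosterman m n c = ∑ u : (GaussianInt ⧸ Ideal.span {c})ˣ,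
      gaussChar c hc ((u : GaussianInt ⧸ Ideal.span {c}) * Ideal.Quotient.mk _ m +
        ((u⁻¹ : (GaussianInt ⧸ Ideal.span {c})ˣ) : GaussianInt ⧸ Ideal.span {c}) *
          Ideal.Quotient.mk _ n) := by
  rw [kloosterman, finsum_eq_sum_of_fintype]
  refine Finset.sum_congr rfl fun u _ => ?_
  rw [← gaussChar_mk c hc, map_add, map_mul, map_mul, mk_out, mk_out]

lemma floor_fiber (D : ℕ) (hD : 4 ≤ D) (v v' : ℝ) (hv : |v| ≤ D / 4) (hv' : |v'| ≤ D / 4)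
    (h : ((⌊v⌋ : ℤ) : ZMod D) = ((⌊v'⌋ : ℤ) : ZMod D)) : |v - v'| ≤ 1 := by
  have hD' : (4:ℝ) ≤ D := by exact_mod_cast hD
  rw [ZMod.intCast_eq_intCast_iff_dvd_sub] at h
  rw [abs_le] at hv hv'
  have a1 := Int.floor_le v
  have a2 := Int.lt_floor_add_one v
  have a3 := Int.floor_le v'
  have a4 := Int.lt_floor_add_one v'
  have hz : ⌊v'⌋ - ⌊v⌋ = 0 := by
    apply Int.eq_zero_of_abs_lt_dvd h
    rw [abs_lt]
    constructor
    · have : (-(D:ℝ)) < ((⌊v'⌋ - ⌊v⌋ : ℤ) : ℝ) := by push_cast; linarith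
      exact_mod_cast this
    · have : ((⌊v'⌋ - ⌊v⌋ : ℤ) : ℝ) < (D:ℝ) := by push_cast; linarith
      exact_mod_cast this
  have hz' : (⌊v'⌋ : ℝ) = ⌊v⌋ := by
    have : ⌊v'⌋ = ⌊v⌋ := by omega
    exact_mod_cast this
  rw [abs_le]
  constructor <;> linarith

lemma floor_grid (δ v : ℝ) (hδ : 0 < δ) : |v - δ * (⌊v / δ⌋ : ℝ)| ≤ δ := by
  have a1 := Int.floor_le (v / δ)
  have a2 := Int.lt_floor_add_one (v / δ)
  rw [le_div_iff₀ hδ] at a1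
  rw [div_lt_iff₀ hδ] at a2
  rw [abs_le]
  constructor <;> nlinarith

/-- The principal square root. -/
noncomputable def csq (z : ℂ) : ℂ := z ^ ((1:ℂ) / 2)

lemma csq_sq (z : ℂ) : csq z ^ 2 = z := by
  have := Complex.cpow_nat_inv_pow z (n := 2) two_ne_zero
  rw [csq, one_div]
  exact_mod_cast this

lemma csq_norm (z : ℂ) : ‖csq z‖ ^ 2 = ‖z‖ := by
  rw [← norm_pow, csq_sq]

lemma kloosterman_op (c : GaussianInt) (hc : c ≠ 0) (w : ℂ) (hw : w ≠ 0) (N : ℝ) (hN : 0 < N)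
    (A : Finset GaussianInt) (hA : ∀ m ∈ A, ‖(m : ℂ)‖ ≤ Real.sqrt 2 * N) (D : ℕ) (hD4 : 4 ≤ D)
    (hD : 32 * (Real.sqrt 2 * N * ‖w‖ ^ 2) ≤ D) :
    OpBound A (fun m n => kloosterman m n c *
        Complex.exp (4 * Real.pi * I * ((w * csq m) * (w * csq n)).re))
      (9 * ‖(c : ℂ)‖ ^ 2 * D *
        (2 * Real.sqrt (4 * Real.sqrt 2 * N / (D * ‖w‖ ^ 2 * ‖(c : ℂ)‖ ^ 2)) + 1) ^ 2
        * Real.exp (24 * Real.pi)) := by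
  classical
  haveI : NeZero D := ⟨by omega⟩
  obtain ⟨_, hcard⟩ := quot_finite_card c hc
  have hD' : (4:ℝ) ≤ D := by exact_mod_cast hD4
  have hwp : 0 < ‖w‖ := norm_pos_iff.2 hw
  have hcp : 0 < ‖(c : ℂ)‖ := lt_of_lt_of_le one_pos (norm_gauss_one_le hc)
  set Z := Real.sqrt 2 * N with hZ
  have hZp : 0 < Z := by positivity
  set X := Real.sqrt (Z * ‖w‖ ^ 2) with hXdef
  have hX2 : X ^ 2 = Z * ‖w‖ ^ 2 := Real.sq_sqrt (by positivity)
  have hX0 : 0 ≤ X := Real.sqrt_nonneg _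
  set δ := Real.sqrt (1 / (2 * D)) with hδdef
  have hδ2 : δ ^ 2 = 1 / (2 * D) := Real.sq_sqrt (by positivity)
  have hδ0 : 0 < δ := Real.sqrt_pos.2 (by positivity)
  have hDδ : 2 * δ ^ 2 * D = 1 := by rw [hδ2]; field_simp
  have hXD : 32 * X ^ 2 ≤ D := by rw [hX2]; exact hD
  set ρ := Real.sqrt (4 * Real.sqrt 2 * N / (D * ‖w‖ ^ 2 * ‖(c : ℂ)‖ ^ 2)) with hρdef
  have hρ0 : 0 ≤ ρ := Real.sqrt_nonneg _
  have hρ2 : ρ ^ 2 = 4 * Z / (D * ‖w‖ ^ 2 * ‖(c : ℂ)‖ ^ 2) := by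
    rw [hρdef, Real.sq_sqrt (by positivity), hZ]; ring
  have hXδ : X ≤ D / 4 * δ := by
    apply le_of_sq_le_sq _ (by positivity)
    rw [mul_pow, hδ2]
    have : ((D:ℝ) / 4) ^ 2 * (1 / (2 * D)) = D / 32 := by field_simp; norm_num
    rw [this]; linarith
  have hδ1 : δ ≤ 1 := by
    have : δ ^ 2 ≤ 1 := by nlinarith
    nlinarith
  have hXδ1 : X * δ ≤ 1 := by nlinarith
  set y : GaussianInt → ℂ := fun m => w * csq m with hy
  have hyX : ∀ m ∈ A, ‖y m‖ ≤ X := by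
    intro m hm
    apply le_of_sq_le_sq _ hX0
    rw [hX2, hy, norm_mul, mul_pow, csq_norm, mul_comm]
    have := hA m hm
    gcongr
  set k : GaussianInt → ℤ := fun m => ⌊(y m).re / δ⌋ with hk
  set l : GaussianInt → ℤ := fun m => ⌊(y m).im / δ⌋ with hl
  set g : GaussianInt → GaussianInt ⧸ Ideal.span {c} := fun m => Ideal.Quotient.mk _ m with hg
  set p : GaussianInt → ZMod D × ZMod D := fun m => ((k m : ZMod D), (l m : ZMod D)) with hp
  -- fibres
  have hfib : ∀ j, ((A.filter (fun m => (g m, p m) = j)).card : ℝ) ≤ (2 * ρ + 1) ^ 2 := by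
    intro j
    rcases (A.filter (fun m => (g m, p m) = j)).eq_empty_or_nonempty with he | ⟨m0, hm0⟩
    · rw [he]; simp; positivity
    rw [Finset.mem_filter] at hm0
    have hex : ∀ m, (g m, p m) = j → ∃ q, m - m0 = c * q := by
      intro m hm
      have h1 : g m = g m0 := by
        have := hm.trans hm0.2.symm
        exact (Prod.ext_iff.1 this).1
      rw [hg, Ideal.Quotient.mk_eq_mk_iff_sub_mem, Ideal.mem_span_singleton] at h1
      exact h1
    set F := A.filter (fun m => (g m, p m) = j) with hF
    set φ : GaussianInt → GaussianInt := fun m => (m - m0) / c with hφ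
    have hφe : ∀ m ∈ F, m - m0 = c * φ m := by
      intro m hm
      obtain ⟨q, hq⟩ := hex m (Finset.mem_filter.1 hm).2
      rw [hφ]; simp only
      rw [hq, mul_div_cancel_left₀ _ hc]
    have hinj : Set.InjOn φ F := by
      intro m hm m' hm' hmm
      have h1 := hφe m hm
      have h2 := hφe m' hm'
      rw [hmm, ← h2] at h1
      exact sub_left_injective h1
    rw [← Finset.card_image_of_injOn hinj]
    apply card_gauss_le _ _ hρ0
    intro z hz
    obtain ⟨m, hm, rfl⟩ := Finset.mem_image.1 hz
    have h1 := congrArg (fun z : GaussianInt => (z : ℂ)) (hφe m hm)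
    simp only [GaussianInt.toComplex_sub, GaussianInt.toComplex_mul] at h1
    have hmA := (Finset.mem_filter.1 hm).1
    have hpp : p m = p m0 := by
      have := (Finset.mem_filter.1 hm).2.trans hm0.2.symm
      exact (Prod.ext_iff.1 this).2
    have hkk : ((k m : ℤ) : ZMod D) = (k m0 : ZMod D) := (Prod.ext_iff.1 hpp).1
    have hll : ((l m : ℤ) : ZMod D) = (l m0 : ZMod D) := (Prod.ext_iff.1 hpp).2
    have hbd : ∀ v : ℝ, |v| ≤ X → |v / δ| ≤ D / 4 := by
      intro v hv
      rw [abs_div, abs_of_pos hδ0, div_le_iff₀ hδ0]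
      exact hv.trans hXδ
    have hbr : ∀ n ∈ A, |(y n).re / δ| ≤ D / 4 := fun n hn =>
      hbd _ ((Complex.abs_re_le_norm _).trans (hyX n hn))
    have hbi : ∀ n ∈ A, |(y n).im / δ| ≤ D / 4 := fun n hn =>
      hbd _ ((Complex.abs_im_le_norm _).trans (hyX n hn))
    have hr := floor_fiber D hD4 _ _ (hbr m hmA) (hbr m0 hm0.1) hkk
    have hi := floor_fiber D hD4 _ _ (hbi m hmA) (hbi m0 hm0.1) hll
    rw [← sub_div, abs_div, abs_of_pos hδ0, div_le_one hδ0] at hr hi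
    have hyy : ‖y m - y m0‖ ^ 2 ≤ 1 / D := by
      rw [← Complex.normSq_eq_norm_sq, Complex.normSq_apply, Complex.sub_re, Complex.sub_im]
      have e1 := sq_le_sq' (by linarith [neg_abs_le ((y m).re - (y m0).re)])
        ((le_abs_self _).trans hr)
      have e2 := sq_le_sq' (by linarith [neg_abs_le ((y m).im - (y m0).im)])
        ((le_abs_self _).trans hi)
      have : (1:ℝ) / D = 2 * δ ^ 2 := by rw [hδ2]; field_simp
      rw [this]; nlinarith
    have hsum : ‖csq m + csq m0‖ ^ 2 ≤ 4 * Z := by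
      have e1 : ‖csq (m : ℂ)‖ ^ 2 ≤ Z := by rw [csq_norm]; exact hA m hmA
      have e2 : ‖csq (m0 : ℂ)‖ ^ 2 ≤ Z := by rw [csq_norm]; exact hA m0 hm0.1
      have e3 := norm_add_le (csq (m : ℂ)) (csq (m0 : ℂ))
      have e4 := norm_nonneg (csq (m : ℂ) + csq (m0 : ℂ))
      nlinarith [sq_nonneg (‖csq (m : ℂ)‖ - ‖csq (m0 : ℂ)‖)]
    have hprod : w * ((c : ℂ) * φ m) = (y m - y m0) * (csq m + csq m0) := by
      rw [← h1, hy]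
      simp only
      conv_lhs => rw [← csq_sq (m : ℂ), ← csq_sq (m0 : ℂ)]
      ring
    have hn : ‖w‖ ^ 2 * (‖(c : ℂ)‖ ^ 2 * ‖(φ m : ℂ)‖ ^ 2) ≤ 1 / D * (4 * Z) := by
      calc _ = ‖w * ((c : ℂ) * φ m)‖ ^ 2 := by rw [norm_mul, norm_mul]; ring
        _ = ‖y m - y m0‖ ^ 2 * ‖csq m + csq m0‖ ^ 2 := by rw [hprod, norm_mul]; ring
        _ ≤ _ := by gcongr
    apply le_of_sq_le_sq _ hρ0
    rw [hρ2, le_div_iff₀ (by positivity)]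
    have h5 : (D:ℝ) * (‖w‖ ^ 2 * (‖(c : ℂ)‖ ^ 2 * ‖(φ m : ℂ)‖ ^ 2)) ≤ D * (1 / D * (4 * Z)) := by
      gcongr
    have h6 : (D:ℝ) * (1 / D * (4 * Z)) = 4 * Z := by field_simp
    rw [h6] at h5
    linarith
  have hdis := opBound_discrete (gaussChar c hc) (gaussChar_primitive c hc)
    (fun i j : ZMod D × ZMod D => ZMod.stdAddChar (i.1 * j.1) * conj (ZMod.stdAddChar (i.2 * j.2)))
    D (by positivity) (zmod_grid_orth D) A g p _ (by positivity) hfib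
  have hdis' : OpBound A (fun m n => kloosterman m n c *
      (ZMod.stdAddChar ((k n : ZMod D) * (k m : ZMod D)) *
      conj (ZMod.stdAddChar ((l n : ZMod D) * (l m : ZMod D)))))
      (9 * ‖(c : ℂ)‖ ^ 2 * D * (2 * ρ + 1) ^ 2) := by
    intro a b
    simp only [kloosterman_eq c hc]
    refine (hdis a b).trans ?_
    gcongr
  exact hdis'.grid2 δ X D y k l hδ0 hδ1 hX0 hXδ1 hDδ hyX (fun m _ => floor_grid _ _ hδ0)
    (fun m _ => floor_grid _ _ hδ0) (by positivity)

lemma numeric_bound (N d t x D ρ2 : ℝ) (hx : 0 < x) (hx2 : x ≤ 2) (hd : 1 ≤ d) (hdN : d < N)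
    (ht : t = x / d) (hD0 : 0 < D)
    (hD : D ≤ 32 * (Real.sqrt 2 * N * t) + 5)
    (hρ : ρ2 = 4 * Real.sqrt 2 * N / (D * t * d ^ 2)) :
    9 * d ^ 2 * D * (2 * Real.sqrt ρ2 + 1) ^ 2 ≤ 9 * 1000 * (N * d / x) := by
  have hd0 : 0 < d := by linarith
  have hN0 : 0 < N := by linarith
  have ht0 : 0 < t := by rw [ht]; positivity
  have hρ0 : 0 ≤ ρ2 := by rw [hρ]; positivity
  have hs : Real.sqrt 2 ≤ 3 / 2 := by
    rw [Real.sqrt_le_left (by norm_num)]; norm_num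
  have hs0 : 0 ≤ Real.sqrt 2 := Real.sqrt_nonneg _
  have h1 : (2 * Real.sqrt ρ2 + 1) ^ 2 ≤ 8 * ρ2 + 2 := by
    nlinarith [Real.sq_sqrt hρ0, sq_nonneg (2 * Real.sqrt ρ2 - 1)]
  set W := N * d / x with hW
  have hW0 : 0 < W := by positivity
  have h2 : d ^ 2 * D * ρ2 = 4 * Real.sqrt 2 * W := by
    rw [hρ, ht, hW]; field_simp
  have hNd : N * d = W * x := by rw [hW]; field_simp
  have h3 : d ^ 2 * D ≤ 32 * (Real.sqrt 2 * (W * x ^ 2)) + 5 * (W * x) := by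
    calc d ^ 2 * D ≤ d ^ 2 * (32 * (Real.sqrt 2 * N * t) + 5) := by gcongr
      _ = 32 * (Real.sqrt 2 * ((N * d) * x)) + 5 * d * d := by rw [ht]; field_simp
      _ ≤ 32 * (Real.sqrt 2 * ((N * d) * x)) + 5 * N * d := by gcongr
      _ = _ := by rw [hNd, mul_assoc 5 N d, hNd]; ring
  have h4 : W * x ^ 2 ≤ W * 4 := by
    gcongr; nlinarith
  have h5 : W * x ≤ W * 2 := by gcongr
  have h6 : Real.sqrt 2 * (W * x ^ 2) ≤ 3 / 2 * (W * 4) := by gcongr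
  have h7 : Real.sqrt 2 * W ≤ 3 / 2 * W := by gcongr
  calc 9 * d ^ 2 * D * (2 * Real.sqrt ρ2 + 1) ^ 2 ≤ 9 * d ^ 2 * D * (8 * ρ2 + 2) := by gcongr
    _ = 9 * (8 * (d ^ 2 * D * ρ2) + 2 * (d ^ 2 * D)) := by ring
    _ ≤ _ := by rw [h2]; nlinarith

/-- The bound for one exponential. -/
lemma kloosterman_op' (c : GaussianInt) (hc : c ≠ 0) (θ : ℂ) (hθ : θ ≠ 0) (hθ2 : ‖θ‖ ≤ 2)
    (N : ℝ) (hcN : ‖(c : ℂ)‖ < N)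
    (A : Finset GaussianInt) (hA : ∀ m ∈ A, ‖(m : ℂ)‖ ≤ Real.sqrt 2 * N) :
    OpBound A (fun m n => kloosterman m n c *
        Complex.exp (4 * Real.pi * I * (csq m * csq n * θ / c).re))
      (9 * 1000 * (N * ‖(c : ℂ)‖ / ‖θ‖) * Real.exp (24 * Real.pi)) := by
  have hc1 := norm_gauss_one_le hc
  have hc' : (c : ℂ) ≠ 0 := by rwa [Ne, GaussianInt.toComplex_eq_zero]
  have hN : 0 < N := by linarith
  set w := csq (θ / c) with hw
  have hw2 : w ^ 2 = θ / c := csq_sq _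
  have hw0 : w ≠ 0 := by
    intro h; rw [h] at hw2
    have : θ / c ≠ 0 := div_ne_zero hθ hc'
    exact this (by rw [← hw2]; simp)
  have hwn : ‖w‖ ^ 2 = ‖θ‖ / ‖(c : ℂ)‖ := by rw [hw, csq_norm, norm_div]
  have hY : 0 ≤ 32 * (Real.sqrt 2 * N * ‖w‖ ^ 2) := by positivity
  set D := ⌈32 * (Real.sqrt 2 * N * ‖w‖ ^ 2)⌉₊ + 4 with hD
  have h1 : 32 * (Real.sqrt 2 * N * ‖w‖ ^ 2) ≤ D := by
    rw [hD]; push_cast; linarith [Nat.le_ceil (32 * (Real.sqrt 2 * N * ‖w‖ ^ 2))]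
  have h2 : (D:ℝ) ≤ 32 * (Real.sqrt 2 * N * ‖w‖ ^ 2) + 5 := by
    rw [hD]; push_cast; linarith [Nat.ceil_lt_add_one hY]
  have hop := kloosterman_op c hc w hw0 N hN A hA D (by omega) h1
  have hnum := numeric_bound N ‖(c : ℂ)‖ (‖w‖ ^ 2) ‖θ‖ D _ (norm_pos_iff.2 hθ) hθ2 hc1 hcN hwn
    (by rw [hD]; positivity) h2 rfl
  intro a b
  refine le_trans (le_of_eq ?_) ((hop a b).trans ?_)
  · congr 1
    refine Finset.sum_congr rfl fun m _ => Finset.sum_congr rfl fun n _ => ?_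
    beta_reduce
    have : csq m * csq n * θ / c = (w * csq m) * (w * csq n) := by
      rw [mul_div_assoc, ← hw2]; ring
    rw [this]
  · gcongr

lemma cos_csq (m n μ : ℂ) : ((Real.cos (4 * Real.pi * (((m * n) ^ ((1:ℂ)/2) * μ).re)) : ℝ) : ℂ) =
    (Complex.exp (4 * Real.pi * I * (csq m * csq n * μ).re) +
      Complex.exp (4 * Real.pi * I * (csq m * csq n * (-μ)).re)) / 2 := by
  have h : csq (m * n) = csq m * csq n ∨ csq (m * n) = -(csq m * csq n) := by
    apply sq_eq_sq_iff_eq_or_eq_neg.1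
    rw [csq_sq, mul_pow, csq_sq, csq_sq]
  have h2 : Real.cos (4 * Real.pi * (((m * n) ^ ((1:ℂ)/2) * μ).re))
      = Real.cos (4 * Real.pi * ((csq m * csq n * μ).re)) := by
    change Real.cos (4 * Real.pi * ((csq (m * n) * μ).re)) = _
    rcases h with h | h <;> rw [h]
    rw [neg_mul, Complex.neg_re, mul_neg, Real.cos_neg]
  rw [h2, Complex.ofReal_cos, Complex.cos, mul_neg, Complex.neg_re]
  push_cast
  congr 3
  · ring_nf
  · ring_nf

/-- Small-`θ` estimate: for `|θ| < 2^{1/8}` and `|c| < N`,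
`|B(θ,c,N)| ≤ C_ε (N|c|/|θ|) N^ε ‖b_N‖₂²`. -/
theorem kloosterman_quadratic_form_third_bound :
    ∀ ε : ℝ, 0 < ε → ∃ C : ℝ,
      ∀ (b : GaussianInt → ℂ), (∀ m n : GaussianInt, Associated m n → b m = b n) →
        ∀ θ : ℂ, θ ≠ 0 → ‖θ‖ < (2:ℝ) ^ ((1:ℝ)/8) →
          ∀ N : ℝ, 0 < N → ∀ c : GaussianInt, c ≠ 0 → ‖(c : ℂ)‖ < N →
            ‖Bform b θ c N‖ ≤
              C * (N * ‖(c : ℂ)‖ / ‖θ‖) * N ^ ε * sqNorm b N := by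
  classical
  intro ε hε
  refine ⟨9 * 1000 * Real.exp (24 * Real.pi), ?_⟩
  intro b _ θ hθ hθ8 N hN c hc hcN
  have hc1 := norm_gauss_one_le hc
  have hθ2 : ‖θ‖ ≤ 2 := by
    refine hθ8.le.trans ?_
    calc (2:ℝ) ^ ((1:ℝ)/8) ≤ (2:ℝ) ^ (1:ℝ) :=
          Real.rpow_le_rpow_of_exponent_le (by norm_num) (by norm_num)
      _ = 2 := Real.rpow_one 2
  have hfin : {m : GaussianInt | InAnn N m}.Finite :=
    (finite_gauss (Real.sqrt 2 * N)).subset (fun m hm => hm.2.2)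
  set A := hfin.toFinset with hA
  have hAm : ∀ m ∈ A, ‖(m : ℂ)‖ ≤ Real.sqrt 2 * N := by
    intro m hm
    rw [hA, Set.Finite.mem_toFinset] at hm
    exact hm.2.2
  have hB : Bform b θ c N = ∑ m ∈ A, ∑ n ∈ A, b m * conj (b n) * kloosterman m n c *
      Real.cos (4 * Real.pi * ((((m : ℂ) * (n : ℂ)) ^ ((1:ℂ)/2) * θ / (c : ℂ)).re)) := by
    rw [Bform, finsum_mem_eq_finite_toFinset_sum _ hfin]
    refine Finset.sum_congr rfl fun m _ => ?_
    rw [finsum_mem_eq_finite_toFinset_sum _ hfin]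
  have hS : sqNorm b N = ∑ m ∈ A, ‖b m‖ ^ 2 := by
    rw [sqNorm, finsum_mem_eq_finite_toFinset_sum _ hfin]
  have h1 := kloosterman_op' c hc θ hθ hθ2 N hcN A hAm b (fun n => conj (b n))
  have h2 := kloosterman_op' c hc (-θ) (neg_ne_zero.2 hθ) (by rwa [norm_neg]) N hcN A hAm b
    (fun n => conj (b n))
  simp only [norm_neg, RCLike.norm_conj] at h1 h2
  rw [← hS, Real.mul_self_sqrt (by rw [hS]; positivity)] at h1 h2
  have hsplit : Bform b θ c N =
      ((∑ m ∈ A, ∑ n ∈ A, b m * conj (b n) * (kloosterman m n c *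
        Complex.exp (4 * Real.pi * I * (csq m * csq n * θ / c).re))) +
      (∑ m ∈ A, ∑ n ∈ A, b m * conj (b n) * (kloosterman m n c *
        Complex.exp (4 * Real.pi * I * (csq m * csq n * (-θ) / c).re)))) / 2 := by
    rw [hB, ← Finset.sum_add_distrib, Finset.sum_div]
    refine Finset.sum_congr rfl fun m _ => ?_
    rw [← Finset.sum_add_distrib, Finset.sum_div]
    refine Finset.sum_congr rfl fun n _ => ?_
    rw [mul_div_assoc _ θ, cos_csq, mul_div_assoc _ θ, mul_div_assoc _ (-θ), neg_div]
    ring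
  set Q := 9 * 1000 * (N * ‖(c : ℂ)‖ / ‖θ‖) * Real.exp (24 * Real.pi) * sqNorm b N with hQ
  have hS0 : 0 ≤ sqNorm b N := by rw [hS]; positivity
  have hQ0 : 0 ≤ Q := by positivity
  have h3 : ‖Bform b θ c N‖ ≤ Q := by
    rw [hsplit, norm_div, Complex.norm_ofNat, div_le_iff₀ (by norm_num)]
    refine (norm_add_le _ _).trans ?_
    linarith
  have h4 : 1 ≤ N ^ ε := Real.one_le_rpow (by linarith) hε.le
  calc ‖Bform b θ c N‖ ≤ Q := h3
    _ ≤ Q * N ^ ε := le_mul_of_one_le_right hQ0 h4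
    _ = _ := by rw [hQ]; ring
end

section
/- There is an absolute constant C such that for every p ∈ ℤ and every x > 0 one has |J_{2p}(x)| ≤ C·√(1+p²)/√x. -/
open scoped Real
open Complex

/-- `J_{2p}(x) = (1/(2π i^{2p})) ∫₀^{2π} exp(2ipω + i x cos ω) dω`. -/
noncomputable def besselJ (p : ℤ) (x : ℝ) : ℂ :=
  (1 / (2 * Real.pi * Complex.I ^ (2 * p))) *
    ∫ ω in (0:ℝ)..(2 * Real.pi),
      Complex.exp (2 * Complex.I * (p : ℂ) * (ω : ℂ) + Complex.I * (x : ℂ) * (Real.cos ω : ℂ))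

lemma bj_weight (x : ℝ) (hx : 0 < x) (ω : ℝ) (h0 : 0 ≤ ω) (h1 : ω ≤ 2 * π) :
    1 / (1 + x * Real.sin ω ^ 2) ≤
      1 / (1 + (2 / π * √x * ω) ^ 2) + 1 / (1 + (2 / π * √x * (ω - π)) ^ 2)
        + 1 / (1 + (2 / π * √x * (ω - 2 * π)) ^ 2) := by
  have hs : √x ^ 2 = x := Real.sq_sqrt hx.le
  have hpi := Real.pi_pos
  have key : ∀ y : ℝ, |y| ≤ π / 2 → Real.sin y ^ 2 = Real.sin ω ^ 2 →
      1 / (1 + x * Real.sin ω ^ 2) ≤ 1 / (1 + (2 / π * √x * y) ^ 2) := by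
    intro y hy hyω
    have h := Real.mul_abs_le_abs_sin hy
    have h2 : (2 / π * |y|) ^ 2 ≤ |Real.sin y| ^ 2 := by
      apply pow_le_pow_left₀ (by positivity) h
    rw [mul_pow, sq_abs, sq_abs, hyω] at h2
    apply one_div_le_one_div_of_le (by positivity)
    have : (2 / π * √x * y) ^ 2 = x * ((2 / π) ^ 2 * y ^ 2) := by
      rw [mul_pow, mul_pow, hs]; ring
    rw [this]
    nlinarith [mul_le_mul_of_nonneg_left h2 hx.le]
  have p1 : 0 ≤ 1 / (1 + (2 / π * √x * ω) ^ 2) := by positivity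
  have p2 : 0 ≤ 1 / (1 + (2 / π * √x * (ω - π)) ^ 2) := by positivity
  have p3 : 0 ≤ 1 / (1 + (2 / π * √x * (ω - 2 * π)) ^ 2) := by positivity
  rcases le_total ω (π / 2) with h | h
  · have := key ω (by rw [abs_le]; constructor <;> linarith) rfl
    linarith
  · rcases le_total ω (3 * π / 2) with h' | h'
    · have := key (ω - π) (by rw [abs_le]; constructor <;> linarith) (by simp [Real.sin_sub_pi])
      linarith
    · have := key (ω - 2 * π) (by rw [abs_le]; constructor <;> linarith)
        (by simp [Real.sin_sub_two_pi])
      linarith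

lemma bj_bump (c : ℝ) (hc : c ≠ 0) (a ω : ℝ) :
    HasDerivAt (fun ω : ℝ => Real.arctan (c * (ω - a)) / c) (1 / (1 + (c * (ω - a)) ^ 2)) ω := by
  have h : HasDerivAt (fun ω : ℝ => c * (ω - a)) c ω := by
    simpa using ((hasDerivAt_id ω).sub_const a).const_mul c
  have := (h.arctan).div_const c
  refine this.congr_deriv ?_
  field_simp

lemma bj_integral (p : ℤ) (x : ℝ) (hx : 0 < x) :
    ‖∫ ω in (0:ℝ)..(2 * π),
      Complex.exp (2 * Complex.I * (p : ℂ) * (ω : ℂ) + Complex.I * (x : ℂ) * (Real.cos ω : ℂ))‖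
      ≤ (3 * π ^ 2 + 2 * π * |(p : ℝ)|) / √x := by
  have hpi := Real.pi_pos
  have hs : √x ^ 2 = x := Real.sq_sqrt hx.le
  have hsp : 0 < √x := Real.sqrt_pos.2 hx
  set G : ℝ → ℂ := fun ω => Complex.exp (2 * Complex.I * (p : ℂ) * (ω : ℂ) +
    Complex.I * (x : ℂ) * (Real.cos ω : ℂ)) with hG
  have hGn : ∀ ω, ‖G ω‖ = 1 := by
    intro ω
    have : G ω = Complex.exp (((2 * p * ω + x * Real.cos ω : ℝ) : ℂ) * Complex.I) := by
      simp only [hG]; congr 1; push_cast; ring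
    rw [this, Complex.norm_exp_ofReal_mul_I]
  have hGc : Continuous G := by fun_prop
  have hGd : ∀ ω : ℝ, HasDerivAt G
      (G ω * (2 * Complex.I * p - Complex.I * x * (Real.sin ω : ℂ))) ω := by
    intro ω
    have h1 : HasDerivAt (fun ω : ℝ => (ω : ℂ)) 1 ω := Complex.ofRealCLM.hasDerivAt
    have h2 : HasDerivAt (fun ω : ℝ => (Real.cos ω : ℂ)) ((-Real.sin ω : ℝ) : ℂ) ω :=
      (Real.hasDerivAt_cos ω).ofReal_comp
    have h3 := ((h1.const_mul (2 * Complex.I * (p : ℂ))).add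
      (h2.const_mul (Complex.I * (x : ℂ)))).cexp
    refine h3.congr_deriv ?_
    simp only [hG, Pi.add_apply, Complex.ofReal_neg]
    ring
  have hD : ∀ ω : ℝ, 0 < 1 + x * Real.sin ω ^ 2 := fun ω => by positivity
  set H : ℝ → ℝ := fun ω => Real.sin ω / (1 + x * Real.sin ω ^ 2) with hH
  set H' : ℝ → ℝ := fun ω => Real.cos ω * (1 - x * Real.sin ω ^ 2) / (1 + x * Real.sin ω ^ 2) ^ 2
    with hH'
  have hHd : ∀ ω, HasDerivAt H (H' ω) ω := by
    intro ω
    have h1 := Real.hasDerivAt_sin ω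
    have h2 := ((h1.pow 2).const_mul x).const_add 1
    have h3 := h1.div h2 (hD ω).ne'
    refine h3.congr_deriv ?_
    simp only [hH', Pi.pow_apply]
    congr 1
    push_cast
    ring
  have hHc : Continuous H := by
    simp only [hH]; exact Continuous.div (by fun_prop) (by fun_prop) (fun ω => (hD ω).ne')
  have hH'c : Continuous H' := by
    simp only [hH']
    exact Continuous.div (by fun_prop) (by fun_prop) (fun ω => (pow_pos (hD ω) 2).ne')
  set K : ℝ → ℂ := fun ω => (H ω : ℂ) * G ω with hK
  set K' : ℝ → ℂ := fun ω => (H' ω : ℂ) * G ω +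
    (H ω : ℂ) * (G ω * (2 * Complex.I * p - Complex.I * x * (Real.sin ω : ℂ))) with hK'
  have hKd : ∀ ω, HasDerivAt K (K' ω) ω := fun ω => ((hHd ω).ofReal_comp).mul (hGd ω)
  have hK'c : Continuous K' := by
    simp only [hK']; fun_prop
  have hKint : ∫ ω in (0:ℝ)..(2 * π), K' ω = 0 := by
    rw [intervalIntegral.integral_eq_sub_of_hasDerivAt (fun ω _ => hKd ω)
      (hK'c.intervalIntegrable _ _)]
    simp [hK, hH]
  have heq : ∫ ω in (0:ℝ)..(2 * π), G ω = ∫ ω in (0:ℝ)..(2 * π), (G ω - Complex.I * K' ω) := by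
    rw [intervalIntegral.integral_sub (hGc.intervalIntegrable _ _)
      ((hK'c.intervalIntegrable _ _).const_mul Complex.I),
      intervalIntegral.integral_const_mul, hKint]
    simp
  set c : ℝ := 2 / π * √x with hc
  have hcp : 0 < c := by positivity
  set Φ : ℝ → ℝ := fun ω => 2 * (Real.arctan (c * (ω - 0)) / c + Real.arctan (c * (ω - π)) / c
    + Real.arctan (c * (ω - 2 * π)) / c) + |(p : ℝ)| / √x * ω with hΦ
  set Φ' : ℝ → ℝ := fun ω => 2 * (1 / (1 + (c * (ω - 0)) ^ 2) + 1 / (1 + (c * (ω - π)) ^ 2)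
    + 1 / (1 + (c * (ω - 2 * π)) ^ 2)) + |(p : ℝ)| / √x * 1 with hΦ'
  have hΦd : ∀ ω, HasDerivAt Φ (Φ' ω) ω := fun ω =>
    ((((bj_bump c hcp.ne' 0 ω).add (bj_bump c hcp.ne' π ω)).add
      (bj_bump c hcp.ne' (2 * π) ω)).const_mul 2).add ((hasDerivAt_id ω).const_mul _)
  have hΦ'c : Continuous Φ' := by
    have hb : ∀ a : ℝ, Continuous fun ω : ℝ => 1 / (1 + (c * (ω - a)) ^ 2) := fun a =>
      Continuous.div (by fun_prop) (by fun_prop) (fun ω => by positivity)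
    exact ((((hb 0).add (hb π)).add (hb (2 * π))).const_mul 2).add continuous_const
  have hpt : ∀ ω : ℝ, 0 ≤ ω → ω ≤ 2 * π → ‖G ω - Complex.I * K' ω‖ ≤ Φ' ω := by
    intro ω h0 h1
    have hw := bj_weight x hx ω h0 h1
    set w := 1 / (1 + x * Real.sin ω ^ 2) with hwd
    have hDω := hD ω
    have e1 : G ω - Complex.I * K' ω =
        ((w : ℝ) : ℂ) * G ω - Complex.I * (H' ω : ℂ) * G ω + ((2 * p * H ω : ℝ) : ℂ) * G ω := by
      have hne : (1 + (x : ℂ) * (Real.sin ω : ℂ) ^ 2) ≠ 0 := by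
        exact_mod_cast hDω.ne'
      have hw1 : (w : ℂ) = 1 - x * Real.sin ω * H ω := by
        simp only [hwd, hH]
        push_cast
        push_cast at hne
        field_simp
        ring
      rw [hw1]
      simp only [hK']
      push_cast
      linear_combination (-(2 * (p : ℂ) * H ω * G ω) + x * Complex.sin ω * H ω * G ω) * Complex.I_sq
    have hwpos : 0 < w := by positivity
    have b1 : |H' ω| ≤ w := by
      simp only [hH', hwd]
      rw [abs_div, abs_mul, abs_of_pos (pow_pos hDω 2), div_le_div_iff₀ (pow_pos hDω 2) hDω]
      have hc1 := Real.abs_cos_le_one ω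
      have hd1 : |1 - x * Real.sin ω ^ 2| ≤ 1 + x * Real.sin ω ^ 2 := by
        have : 0 ≤ x * Real.sin ω ^ 2 := by positivity
        rw [abs_le]; constructor <;> linarith
      have := mul_le_mul hc1 hd1 (abs_nonneg _) zero_le_one
      nlinarith
    have b2 : 2 * |H ω| ≤ 1 / √x := by
      simp only [hH]
      rw [abs_div, abs_of_pos hDω, ← mul_div_assoc, div_le_div_iff₀ hDω hsp]
      have : x * Real.sin ω ^ 2 = (√x * |Real.sin ω|) ^ 2 := by rw [mul_pow, hs, sq_abs]
      rw [this]
      nlinarith [sq_nonneg (√x * |Real.sin ω| - 1)]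
    have b3 : ‖G ω - Complex.I * K' ω‖ ≤ w + |H' ω| + |2 * p * H ω| := by
      rw [e1]
      refine (norm_add_le _ _).trans (add_le_add ((norm_sub_le _ _).trans (add_le_add ?_ ?_)) ?_)
      · rw [norm_mul, hGn, Complex.norm_real, Real.norm_eq_abs, abs_of_pos hwpos, mul_one]
      · rw [norm_mul, norm_mul, hGn, Complex.norm_real, Complex.norm_I, Real.norm_eq_abs]; simp
      · rw [norm_mul, hGn, Complex.norm_real, Real.norm_eq_abs, mul_one]
    have b4 : |2 * p * H ω| ≤ |(p : ℝ)| / √x := by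
      rw [abs_mul, abs_mul, abs_two]
      have := mul_le_mul_of_nonneg_left b2 (abs_nonneg (p : ℝ))
      rw [mul_one_div] at this
      linarith
    simp only [hΦ', sub_zero, mul_one]
    linarith
  rw [heq]
  have h2pi : (0:ℝ) ≤ 2 * π := by positivity
  have hle := intervalIntegral.norm_integral_le_of_norm_le (μ := MeasureTheory.volume) h2pi
    (Filter.Eventually.of_forall fun ω hω => hpt ω hω.1.le hω.2) (hΦ'c.intervalIntegrable _ _)
  refine hle.trans ?_
  rw [intervalIntegral.integral_eq_sub_of_hasDerivAt (fun ω _ => hΦd ω)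
      (hΦ'c.intervalIntegrable _ _)]
  have hat : ∀ y z : ℝ, Real.arctan y / c - Real.arctan z / c ≤ π / c := by
    intro y z
    rw [← sub_div]
    apply div_le_div_of_nonneg_right _ hcp.le
    linarith [Real.arctan_lt_pi_div_two y, Real.neg_pi_div_two_lt_arctan z]
  have hfin : (3 * π ^ 2 + 2 * π * |(p : ℝ)|) / √x = 2 * (3 * (π / c)) + |(p : ℝ)| / √x * (2 * π) := by
    rw [hc]; field_simp
  rw [hfin]
  simp only [hΦ]
  have a1 := hat (c * (2 * π - 0)) (c * (0 - 0))
  have a2 := hat (c * (2 * π - π)) (c * (0 - π))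
  have a3 := hat (c * (2 * π - 2 * π)) (c * (0 - 2 * π))
  linarith

/-- Uniform bound `|J_{2p}(x)| ≤ C √(1+p²)/√x`. -/
theorem besselJ_uniform_bound :
    ∃ C : ℝ, ∀ (p : ℤ) (x : ℝ), 0 < x →
      ‖besselJ p x‖ ≤ C * Real.sqrt (1 + (p : ℝ) ^ 2) / Real.sqrt x := by
  refine ⟨3 * π / 2 + 1, fun p x hx => ?_⟩
  have hpi := Real.pi_pos
  have hsp : 0 < √x := Real.sqrt_pos.2 hx
  have h := bj_integral p x hx
  have hn : ‖(1 / (2 * Real.pi * Complex.I ^ (2 * p)) : ℂ)‖ = 1 / (2 * π) := by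
    simp [abs_of_pos hpi]
  rw [besselJ, norm_mul, hn]
  refine (mul_le_mul_of_nonneg_left h (by positivity)).trans ?_
  have e : 1 / (2 * π) * ((3 * π ^ 2 + 2 * π * |(p : ℝ)|) / √x) = (3 * π / 2 + |(p : ℝ)|) / √x := by
    field_simp
  rw [e]
  apply div_le_div_of_nonneg_right _ hsp.le
  have s1 : 1 ≤ √(1 + (p : ℝ) ^ 2) := by
    rw [Real.one_le_sqrt]; nlinarith [sq_nonneg (p : ℝ)]
  have s2 : |(p : ℝ)| ≤ √(1 + (p : ℝ) ^ 2) := by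
    apply Real.abs_le_sqrt; linarith
  nlinarith
end

section
/- Let z ∈ ℂ and define F : ℝ² → ℝ by F(r,ω) = cos(2·Re(z·trh(r,ω))), where trh(r,ω) = cosh r·cos ω + i·sinh r·sin ω. Then for all (r,ω) ∈ ℝ², ∂²F/∂r²(r,ω) + ∂²F/∂ω²(r,ω) = −4·(sinh²r + sin²ω)·|z|²·F(r,ω). -/
open scoped Real
open Complex

/-- `trh(r,ω) = cosh r cos ω + i sinh r sin ω`. -/
noncomputable def trh (r ω : ℝ) : ℂ :=
  (Real.cosh r * Real.cos ω : ℝ) + Complex.I * (Real.sinh r * Real.sin ω : ℝ)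

theorem trh_re_aux (z : ℂ) (r ω : ℝ) : 2 * (z * trh r ω).re =
    2 * (z.re * (Real.cosh r * Real.cos ω) - z.im * (Real.sinh r * Real.sin ω)) := by
  unfold trh
  rw [Complex.mul_re, Complex.add_re, Complex.add_im, Complex.I_mul_re, Complex.I_mul_im]
  simp only [Complex.ofReal_re, Complex.ofReal_im]
  ring

theorem deriv2_cos_aux (u v w : ℝ → ℝ) (hu : ∀ x, HasDerivAt u (v x) x)
    (hv : ∀ x, HasDerivAt v (w x) x) (x : ℝ) :
    deriv (deriv (fun y => Real.cos (u y))) x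
      = -Real.cos (u x) * v x ^ 2 - Real.sin (u x) * w x := by
  have h1 : deriv (fun y => Real.cos (u y)) = fun y => -Real.sin (u y) * v y :=
    funext fun y => (hu y).cos.deriv
  rw [h1]
  have h2 := ((hu x).sin.fun_neg.fun_mul (hv x)).deriv
  rw [h2]
  ring

/-- The Laplacian identity
`∂²F/∂r² + ∂²F/∂ω² = −4 (sinh²r + sin²ω) |z|² F` for `F(r,ω) = cos(2 Re(z trh(r,ω)))`. -/
theorem laplacian_cos_trh (z : ℂ) (r ω : ℝ) :
    deriv (deriv (fun r' : ℝ => Real.cos (2 * (z * trh r' ω).re))) r +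
      deriv (deriv (fun ω' : ℝ => Real.cos (2 * (z * trh r ω').re))) ω =
      -4 * (Real.sinh r ^ 2 + Real.sin ω ^ 2) * ‖z‖ ^ 2 *
        Real.cos (2 * (z * trh r ω).re) := by
  simp only [trh_re_aux]
  rw [deriv2_cos_aux
      (fun x => 2 * (z.re * (Real.cosh x * Real.cos ω) - z.im * (Real.sinh x * Real.sin ω)))
      (fun x => 2 * (z.re * (Real.sinh x * Real.cos ω) - z.im * (Real.cosh x * Real.sin ω)))
      (fun x => 2 * (z.re * (Real.cosh x * Real.cos ω) - z.im * (Real.sinh x * Real.sin ω)))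
      (fun x => ((((Real.hasDerivAt_cosh x).mul_const _).const_mul _).sub
        (((Real.hasDerivAt_sinh x).mul_const _).const_mul _)).const_mul _)
      (fun x => ((((Real.hasDerivAt_sinh x).mul_const _).const_mul _).sub
        (((Real.hasDerivAt_cosh x).mul_const _).const_mul _)).const_mul _) r,
    deriv2_cos_aux
      (fun x => 2 * (z.re * (Real.cosh r * Real.cos x) - z.im * (Real.sinh r * Real.sin x)))
      (fun x => 2 * (z.re * (Real.cosh r * -Real.sin x) - z.im * (Real.sinh r * Real.cos x)))
      (fun x => 2 * (z.re * (Real.cosh r * -Real.cos x) - z.im * (Real.sinh r * -Real.sin x)))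
      (fun x => ((((Real.hasDerivAt_cos x).const_mul _).const_mul _).sub
        (((Real.hasDerivAt_sin x).const_mul _).const_mul _)).const_mul _)
      (fun x => ((((Real.hasDerivAt_sin x).fun_neg.const_mul _).const_mul _).sub
        (((Real.hasDerivAt_cos x).const_mul _).const_mul _)).const_mul _) ω]
  have hn : ‖z‖ ^ 2 = z.re ^ 2 + z.im ^ 2 := by
    rw [← Complex.normSq_eq_norm_sq, Complex.normSq_apply]; ring
  rw [hn]
  generalize Real.cos (2 * (z.re * (Real.cosh r * Real.cos ω)
    - z.im * (Real.sinh r * Real.sin ω))) = C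
  generalize Real.sin (2 * (z.re * (Real.cosh r * Real.cos ω)
    - z.im * (Real.sinh r * Real.sin ω))) = S
  have h1 := Real.cosh_sq r
  have h2 := Real.cos_sq' ω
  generalize Real.cosh r = a at *
  generalize Real.cos ω = c at *
  generalize Real.sinh r = b at *
  generalize Real.sin ω = s at *
  ring_nf
  simp only [h1, h2]
  ring
end

section
/- For every K, P > 0 and every z ∈ ℂ, −∫_ℝ ∫₀^π cos(2·Re(z·trh(r,ω)))·(k''(r)·θ(ω) + k(r)·θ''(ω)) dω dr = 4|z|² ∫_ℝ ∫₀^π cos(2·Re(z·trh(r,ω)))·(sinh²r + sin²ω)·k(r)·θ(ω) dω dr. -/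
open scoped Real
open Complex

/-- `k(r) = √π K exp(−K²r²)`. -/
noncomputable def kfun (K r : ℝ) : ℝ := Real.sqrt Real.pi * K * Real.exp (-(K ^ 2 * r ^ 2))

/-- `θ(ω) = √π P Σ_{q∈ℤ} exp(−P²(ω+πq)²)`. -/
noncomputable def thetafun (P ω : ℝ) : ℝ :=
  Real.sqrt Real.pi * P * ∑' q : ℤ, Real.exp (-(P ^ 2 * (ω + Real.pi * q) ^ 2))


lemma tau_im_pos (P : ℝ) (hP : 0 < P) : 0 < (Complex.I * Real.pi * (P:ℂ)^2).im := by
  have : Complex.I * Real.pi * (P:ℂ)^2 = ((Real.pi * P^2 : ℝ):ℂ) * Complex.I := by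
    push_cast; ring
  rw [this, Complex.mul_I_im, Complex.ofReal_re]
  have := Real.pi_pos
  positivity

lemma theta_eq (P ω : ℝ) (hP : 0 < P) : thetafun P ω =
    (Real.sqrt Real.pi * P * Real.exp (-(P^2*ω^2))) *
      (jacobiTheta₂ (Complex.I * (P:ℂ)^2 * ω) (Complex.I * Real.pi * (P:ℂ)^2)).re := by
  unfold thetafun
  have h := Complex.hasSum_re (hasSum_jacobiTheta₂_term (Complex.I * (P:ℂ)^2 * ω) (tau_im_pos P hP))
  rw [mul_assoc (Real.sqrt Real.pi * P) (Real.exp _)]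
  congr 1
  rw [← h.tsum_eq, ← tsum_mul_left]
  apply tsum_congr
  intro q
  have e : jacobiTheta₂_term q (Complex.I * (P:ℂ)^2 * ω) (Complex.I * Real.pi * (P:ℂ)^2)
      = ((Real.exp (-(2 * Real.pi * q * P^2 * ω) - Real.pi^2 * q^2 * P^2) : ℝ) : ℂ) := by
    unfold jacobiTheta₂_term
    push_cast
    congr 1
    linear_combination (2 * Real.pi * q * (P:ℂ)^2 * ω + Real.pi^2 * q^2 * (P:ℂ)^2) * Complex.I_sq
  rw [e, Complex.ofReal_re, ← Real.exp_add]
  congr 1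
  ring

lemma theta_contDiff (P : ℝ) (hP : 0 < P) : ContDiff ℝ 2 (thetafun P) := by
  have h1 : ContDiff ℂ 2 (fun w : ℂ => jacobiTheta₂ w (Complex.I * Real.pi * (P:ℂ)^2)) := by
    apply Differentiable.contDiff
    intro w
    exact differentiableAt_jacobiTheta₂_fst w (tau_im_pos P hP)
  have h2 : ContDiff ℝ 2 (fun ω : ℝ =>
      (jacobiTheta₂ (Complex.I * (P:ℂ)^2 * ω) (Complex.I * Real.pi * (P:ℂ)^2)).re) := by
    apply Complex.reCLM.contDiff.comp
    apply (h1.restrict_scalars ℝ).comp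
    exact contDiff_const.mul Complex.ofRealCLM.contDiff
  have h3 : thetafun P = _ := funext fun ω => theta_eq P ω hP
  rw [h3]
  apply ContDiff.mul _ h2
  fun_prop

lemma theta_periodic (P ω : ℝ) : thetafun P (ω + Real.pi) = thetafun P ω := by
  unfold thetafun
  congr 1
  rw [← (Equiv.addRight (1:ℤ)).tsum_eq (fun q : ℤ => Real.exp (-(P ^ 2 * (ω + Real.pi * q) ^ 2)))]
  congr 1; ext q
  simp only [Equiv.coe_addRight]
  push_cast
  ring_nf

lemma theta_deriv_pi (P : ℝ) : deriv (thetafun P) Real.pi = deriv (thetafun P) 0 := by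
  have h : (fun ω => thetafun P (ω + Real.pi)) = thetafun P := funext (theta_periodic P)
  have := deriv_comp_add_const (thetafun P) Real.pi 0
  rw [h, zero_add] at this
  exact this.symm

lemma theta_hasDeriv (P : ℝ) (hP : 0 < P) (x : ℝ) :
    HasDerivAt (thetafun P) (deriv (thetafun P) x) x :=
  ((theta_contDiff P hP).differentiable (by norm_num) x).hasDerivAt

lemma theta_contDiff1 (P : ℝ) (hP : 0 < P) : ContDiff ℝ 1 (deriv (thetafun P)) :=
  ((contDiff_succ_iff_deriv (n := 1)).1 (theta_contDiff P hP)).2.2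

lemma theta_hasDeriv2 (P : ℝ) (hP : 0 < P) (x : ℝ) :
    HasDerivAt (deriv (thetafun P)) (deriv (deriv (thetafun P)) x) x :=
  ((theta_contDiff1 P hP).differentiable (by norm_num) x).hasDerivAt

lemma theta_cont2 (P : ℝ) (hP : 0 < P) : Continuous (deriv (deriv (thetafun P))) :=
  (theta_contDiff1 P hP).continuous_deriv le_rfl

lemma k_hasDeriv (K x : ℝ) : HasDerivAt (kfun K) (-(2*K^2*x) * kfun K x) x := by
  unfold kfun
  have h : HasDerivAt (fun r : ℝ => -(K^2 * r^2)) (-(K^2*(2*x))) x := by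
    convert! (((hasDerivAt_id x).pow 2).const_mul (K^2)).neg using 1; simp
  convert! (h.exp.const_mul (Real.sqrt Real.pi * K)) using 1
  ring

lemma k_deriv (K : ℝ) : deriv (kfun K) = fun x => -(2*K^2*x) * kfun K x :=
  funext fun x => (k_hasDeriv K x).deriv

lemma k_hasDeriv2 (K x : ℝ) :
    HasDerivAt (fun x => -(2*K^2*x) * kfun K x) ((4*K^4*x^2 - 2*K^2) * kfun K x) x := by
  have h : HasDerivAt (fun r : ℝ => -(2*K^2 * r)) (-(2*K^2)) x := by
    convert! ((hasDerivAt_id x).const_mul (2*K^2)).neg using 1; simp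
  convert! h.mul (k_hasDeriv K x) using 1
  ring

lemma k_deriv2 (K : ℝ) : deriv (deriv (kfun K)) = fun x => (4*K^4*x^2 - 2*K^2) * kfun K x := by
  rw [k_deriv]
  exact funext fun x => (k_hasDeriv2 K x).deriv

lemma k_cont (K : ℝ) : Continuous (kfun K) := by
  unfold kfun; fun_prop

lemma k_nonneg (K : ℝ) (hK : 0 < K) (x : ℝ) : 0 ≤ kfun K x := by
  unfold kfun; positivity

lemma cosh_le_exp_abs' (x : ℝ) : Real.cosh x ≤ Real.exp |x| := by
  rw [Real.cosh_eq]
  have h1 := Real.exp_le_exp.2 (le_abs_self x)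
  have h2 := Real.exp_le_exp.2 (neg_le_abs x)
  linarith

lemma abs_le_cosh' (x : ℝ) : |x| ≤ Real.cosh x := by
  have h1 : |x| ≤ Real.sinh |x| := Real.self_le_sinh_iff.2 (abs_nonneg x)
  have h2 := Real.sinh_lt_cosh |x|
  rw [Real.cosh_abs] at h2
  linarith

lemma abs_sinh_le_cosh' (x : ℝ) : |Real.sinh x| ≤ Real.cosh x := by
  have h2 := Real.sinh_lt_cosh |x|
  rw [Real.cosh_abs] at h2
  rw [Real.abs_sinh]
  exact h2.le

/-- The dominating function is integrable. -/
lemma dom_integrable (K : ℝ) (hK : 0 < K) :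
    MeasureTheory.Integrable (fun r : ℝ => Real.cosh r ^ 2 * kfun K r) := by
  have hb : 0 < K^2/2 := by positivity
  refine ((integrable_exp_neg_mul_sq hb).const_mul
    (Real.sqrt Real.pi * K * Real.exp (2/K^2))).mono' ?_ ?_
  · exact ((Real.continuous_cosh.pow 2).mul (k_cont K)).aestronglyMeasurable
  · filter_upwards with r
    rw [Real.norm_of_nonneg (mul_nonneg (sq_nonneg _) (k_nonneg K hK r))]
    have h1 : Real.cosh r ^ 2 ≤ Real.exp (2*|r|) := by
      have := pow_le_pow_left₀ (Real.cosh_pos r).le (cosh_le_exp_abs' r) 2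
      rwa [← Real.exp_nat_mul] at this
    calc Real.cosh r ^ 2 * kfun K r ≤ Real.exp (2*|r|) * kfun K r :=
          mul_le_mul_of_nonneg_right h1 (k_nonneg K hK r)
      _ = Real.sqrt Real.pi * K * (Real.exp (2*|r| - K^2*r^2)) := by
          unfold kfun
          rw [sub_eq_add_neg, Real.exp_add]; ring
      _ ≤ Real.sqrt Real.pi * K * (Real.exp (2/K^2 + -(K^2/2)*r^2)) := by
          apply mul_le_mul_of_nonneg_left _ (by positivity)
          apply Real.exp_le_exp.2
          have h3 : 0 ≤ (K*|r|/2 - 1/K)^2 * 2 := by positivity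
          have h4 : (K*|r|/2 - 1/K)^2 * 2 = K^2*|r|^2/2 - 2*|r| + 2/K^2 := by
            field_simp; ring
          rw [h4, sq_abs] at h3
          linarith
      _ = _ := by rw [Real.exp_add]; ring

lemma int_of_bound (K : ℝ) (hK : 0 < K) (C : ℝ) (f : ℝ → ℝ) (hf : Continuous f)
    (hb : ∀ r, |f r| ≤ C * (Real.cosh r ^ 2 * kfun K r)) : MeasureTheory.Integrable f := by
  refine ((dom_integrable K hK).const_mul C).mono' hf.aestronglyMeasurable ?_
  filter_upwards with r
  exact hb r

lemma int_prod_of_bound (K : ℝ) (hK : 0 < K) (C : ℝ) (f : ℝ → ℝ → ℝ) (h : ℝ → ℝ)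
    (hf : Continuous (Function.uncurry f)) (hh : Continuous h)
    (hb : ∀ r ω, |f r ω| ≤ C * (Real.cosh r ^ 2 * kfun K r)) :
    MeasureTheory.Integrable (Function.uncurry fun r ω => f r ω * h ω)
      (MeasureTheory.volume.prod (MeasureTheory.volume.restrict (Set.Ioc 0 Real.pi))) := by
  have hh' : MeasureTheory.Integrable (fun ω => |h ω|)
      (MeasureTheory.volume.restrict (Set.Ioc 0 Real.pi)) :=
    (hh.abs.integrableOn_Icc (a := 0) (b := Real.pi)).mono_set Set.Ioc_subset_Icc_self
  refine (((dom_integrable K hK).const_mul C).mul_prod hh').mono' ?_ ?_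
  · apply Continuous.aestronglyMeasurable
    exact hf.mul (hh.comp continuous_snd)
  · filter_upwards with p
    simp only [Function.uncurry, Real.norm_eq_abs, abs_mul]
    exact mul_le_mul_of_nonneg_right (hb _ _) (abs_nonneg _)

/-- phase function and its two derivatives -/
noncomputable def uu (a b r ω : ℝ) : ℝ :=
  2 * (a * (Real.cosh r * Real.cos ω) - b * (Real.sinh r * Real.sin ω))
noncomputable def ur (a b r ω : ℝ) : ℝ :=
  2 * (a * (Real.sinh r * Real.cos ω) - b * (Real.cosh r * Real.sin ω))
noncomputable def uw (a b r ω : ℝ) : ℝ :=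
  2 * (-(a * (Real.cosh r * Real.sin ω)) - b * (Real.sinh r * Real.cos ω))

lemma uu_dr (a b r ω : ℝ) : HasDerivAt (fun r => uu a b r ω) (ur a b r ω) r :=
  ((((Real.hasDerivAt_cosh r).mul_const _).const_mul a).sub
    (((Real.hasDerivAt_sinh r).mul_const _).const_mul b)).const_mul 2
lemma ur_dr (a b r ω : ℝ) : HasDerivAt (fun r => ur a b r ω) (uu a b r ω) r :=
  ((((Real.hasDerivAt_sinh r).mul_const _).const_mul a).sub
    (((Real.hasDerivAt_cosh r).mul_const _).const_mul b)).const_mul 2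
lemma uu_dw (a b r ω : ℝ) : HasDerivAt (fun ω => uu a b r ω) (uw a b r ω) ω := by
  convert! ((((Real.hasDerivAt_cos ω).const_mul (Real.cosh r)).const_mul a).sub
    (((Real.hasDerivAt_sin ω).const_mul (Real.sinh r)).const_mul b)).const_mul 2 using 1
  unfold uw; ring
lemma uw_dw (a b r ω : ℝ) : HasDerivAt (fun ω => uw a b r ω) (-uu a b r ω) ω := by
  convert! ((((Real.hasDerivAt_sin ω).const_mul (Real.cosh r)).const_mul a).neg.sub
    (((Real.hasDerivAt_cos ω).const_mul (Real.sinh r)).const_mul b)).const_mul 2 using 1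
  unfold uu; ring

lemma bnd_aux (a b s c t v M : ℝ) (hs : |s| ≤ M) (ht : |t| ≤ M) (hc : |c| ≤ 1) (hv : |v| ≤ 1) :
    |2 * (a * (s * c) - b * (t * v))| ≤ 2 * (|a| + |b|) * M := by
  have hM : 0 ≤ M := (abs_nonneg _).trans hs
  have h1 : |s * c| ≤ M := by
    rw [abs_mul]; nlinarith [abs_nonneg s, abs_nonneg c]
  have h2 : |t * v| ≤ M := by
    rw [abs_mul]; nlinarith [abs_nonneg t, abs_nonneg v]
  have h3 : |a * (s * c) - b * (t * v)| ≤ |a| * M + |b| * M := by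
    refine (abs_sub _ _).trans ?_
    rw [abs_mul a, abs_mul b]
    gcongr
  rw [abs_mul, abs_two]
  linarith

lemma uu_bnd (a b r ω : ℝ) : |uu a b r ω| ≤ 2 * (|a| + |b|) * Real.cosh r :=
  bnd_aux _ _ _ _ _ _ _ (by rw [abs_of_pos (Real.cosh_pos r)]) (abs_sinh_le_cosh' r)
    (Real.abs_cos_le_one _) (Real.abs_sin_le_one _)
lemma ur_bnd (a b r ω : ℝ) : |ur a b r ω| ≤ 2 * (|a| + |b|) * Real.cosh r :=
  bnd_aux _ _ _ _ _ _ _ (abs_sinh_le_cosh' r) (by rw [abs_of_pos (Real.cosh_pos r)])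
    (Real.abs_cos_le_one _) (Real.abs_sin_le_one _)
lemma uw_bnd (a b r ω : ℝ) : |uw a b r ω| ≤ 2 * (|a| + |b|) * Real.cosh r := by
  have := bnd_aux (-a) b _ _ _ _ _ (by rw [abs_of_pos (Real.cosh_pos r)]) (abs_sinh_le_cosh' r)
    (Real.abs_sin_le_one ω) (Real.abs_cos_le_one ω)
  rw [abs_neg] at this
  unfold uw
  rw [← neg_mul]
  exact this

lemma uu_cont (a b : ℝ) : Continuous (Function.uncurry (uu a b)) := by
  unfold uu Function.uncurry; fun_prop
lemma ur_cont (a b : ℝ) : Continuous (Function.uncurry (ur a b)) := by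
  unfold ur Function.uncurry; fun_prop
lemma uw_cont (a b : ℝ) : Continuous (Function.uncurry (uw a b)) := by
  unfold uw Function.uncurry; fun_prop

noncomputable def FF (a b r ω : ℝ) : ℝ := Real.cos (uu a b r ω)
noncomputable def Fr (a b r ω : ℝ) : ℝ := -Real.sin (uu a b r ω) * ur a b r ω
noncomputable def Fw (a b r ω : ℝ) : ℝ := -Real.sin (uu a b r ω) * uw a b r ω
noncomputable def Frr (a b r ω : ℝ) : ℝ :=
  -Real.cos (uu a b r ω) * ur a b r ω ^ 2 - Real.sin (uu a b r ω) * uu a b r ω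
noncomputable def Fww (a b r ω : ℝ) : ℝ :=
  -Real.cos (uu a b r ω) * uw a b r ω ^ 2 + Real.sin (uu a b r ω) * uu a b r ω

lemma FF_cont (a b : ℝ) : Continuous (Function.uncurry (FF a b)) :=
  Real.continuous_cos.comp (uu_cont a b)
lemma Fr_cont (a b : ℝ) : Continuous (Function.uncurry (Fr a b)) :=
  (Real.continuous_sin.comp (uu_cont a b)).neg.mul (ur_cont a b)
lemma Fw_cont (a b : ℝ) : Continuous (Function.uncurry (Fw a b)) :=
  (Real.continuous_sin.comp (uu_cont a b)).neg.mul (uw_cont a b)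
lemma Frr_cont (a b : ℝ) : Continuous (Function.uncurry (Frr a b)) :=
  ((Real.continuous_cos.comp (uu_cont a b)).neg.mul ((ur_cont a b).pow 2)).sub
    ((Real.continuous_sin.comp (uu_cont a b)).mul (uu_cont a b))
lemma Fww_cont (a b : ℝ) : Continuous (Function.uncurry (Fww a b)) :=
  ((Real.continuous_cos.comp (uu_cont a b)).neg.mul ((uw_cont a b).pow 2)).add
    ((Real.continuous_sin.comp (uu_cont a b)).mul (uu_cont a b))

lemma FF_dr (a b r ω : ℝ) : HasDerivAt (fun r => FF a b r ω) (Fr a b r ω) r :=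
  (uu_dr a b r ω).cos
lemma FF_dw (a b r ω : ℝ) : HasDerivAt (fun ω => FF a b r ω) (Fw a b r ω) ω :=
  (uu_dw a b r ω).cos
lemma Fr_dr (a b r ω : ℝ) : HasDerivAt (fun r => Fr a b r ω) (Frr a b r ω) r := by
  convert! (uu_dr a b r ω).sin.neg.mul (ur_dr a b r ω) using 1
  unfold Frr; simp; ring
lemma Fw_dw (a b r ω : ℝ) : HasDerivAt (fun ω => Fw a b r ω) (Fww a b r ω) ω := by
  convert! (uu_dw a b r ω).sin.neg.mul (uw_dw a b r ω) using 1
  unfold Fww; simp; ring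

lemma FF_bnd (a b r ω : ℝ) : |FF a b r ω| ≤ 1 := Real.abs_cos_le_one _
lemma Fr_bnd (a b r ω : ℝ) : |Fr a b r ω| ≤ 2 * (|a| + |b|) * Real.cosh r := by
  unfold Fr
  rw [abs_mul, abs_neg]
  have := ur_bnd a b r ω
  nlinarith [Real.abs_sin_le_one (uu a b r ω), abs_nonneg (ur a b r ω)]

lemma FF2_aux (c s x y N : ℝ) (hc : |c| ≤ 1) (hs : |s| ≤ 1) (hx : |x| ≤ N) (hy : |y| ≤ N) :
    |-c * x ^ 2 + s * y| ≤ N ^ 2 + N := by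
  have hN : 0 ≤ N := (abs_nonneg _).trans hx
  refine (abs_add_le _ _).trans ?_
  rw [abs_mul, abs_mul, abs_neg, abs_pow]
  have h1 : |x| ^ 2 ≤ N ^ 2 := pow_le_pow_left₀ (abs_nonneg _) hx 2
  have h2 : |c| * |x| ^ 2 ≤ 1 * N ^ 2 := by gcongr
  have h3 : |s| * |y| ≤ 1 * N := by gcongr
  linarith

lemma FF2_aux2 (A c : ℝ) (hA : 0 ≤ A) (hc : 1 ≤ c) :
    (A * c) ^ 2 + A * c ≤ (A ^ 2 + A) * c ^ 2 := by
  have : A * c ≤ A * c ^ 2 := by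
    apply mul_le_mul_of_nonneg_left _ hA; nlinarith
  nlinarith

lemma Fww_bnd (a b r ω : ℝ) : |Fww a b r ω| ≤
    ((2 * (|a| + |b|)) ^ 2 + 2 * (|a| + |b|)) * Real.cosh r ^ 2 :=
  (FF2_aux _ _ _ _ _ (Real.abs_cos_le_one _) (Real.abs_sin_le_one _) (uw_bnd a b r ω)
    (uu_bnd a b r ω)).trans (FF2_aux2 _ _ (by positivity) (Real.one_le_cosh r))
lemma Frr_bnd (a b r ω : ℝ) : |Frr a b r ω| ≤
    ((2 * (|a| + |b|)) ^ 2 + 2 * (|a| + |b|)) * Real.cosh r ^ 2 := by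
  have := (FF2_aux _ (-Real.sin (uu a b r ω)) _ _ _ (Real.abs_cos_le_one (uu a b r ω))
    (by rw [abs_neg]; exact Real.abs_sin_le_one _) (ur_bnd a b r ω)
    (uu_bnd a b r ω)).trans (FF2_aux2 _ _ (by positivity) (Real.one_le_cosh r))
  unfold Frr
  rw [sub_eq_add_neg, ← neg_mul (Real.sin _)]
  exact this

lemma laplace (a b r ω : ℝ) : Frr a b r ω + Fww a b r ω =
    -(4 * (a^2 + b^2) * (FF a b r ω * (Real.sinh r ^ 2 + Real.sin ω ^ 2))) := by
  have h1 : ur a b r ω ^ 2 + uw a b r ω ^ 2 =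
      4 * (a^2 + b^2) * (Real.sinh r ^ 2 + Real.sin ω ^ 2) := by
    unfold ur uw
    have hc := Real.cosh_sq r
    have hs := Real.cos_sq' ω
    linear_combination (4 * (a^2+b^2) * Real.sin ω ^ 2) * hc +
      (4 * (a^2+b^2) * Real.sinh r ^ 2) * hs
  unfold Frr Fww FF
  linear_combination (-Real.cos (uu a b r ω)) * h1

lemma FF_pi (a b r : ℝ) : FF a b r Real.pi = FF a b r 0 := by
  simp [FF, uu]
lemma Fw_pi (a b r : ℝ) : Fw a b r Real.pi = Fw a b r 0 := by
  simp [Fw, uu, uw]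

/-- partial integration in the angular variable -/
lemma ibp_w (P : ℝ) (hP : 0 < P) (a b r : ℝ) :
    ∫ ω in (0:ℝ)..Real.pi, FF a b r ω * deriv (deriv (thetafun P)) ω =
      ∫ ω in (0:ℝ)..Real.pi, Fww a b r ω * thetafun P ω := by
  have cw : Continuous (fun ω => Fw a b r ω) := Continuous.uncurry_left r (Fw_cont a b)
  have cww : Continuous (fun ω => Fww a b r ω) := Continuous.uncurry_left r (Fww_cont a b)
  have e1 := intervalIntegral.integral_mul_deriv_eq_deriv_mul (a := 0) (b := Real.pi)
    (fun x _ => FF_dw a b r x) (fun x _ => theta_hasDeriv2 P hP x)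
    (cw.intervalIntegrable _ _) ((theta_cont2 P hP).intervalIntegrable _ _)
  have e2 := intervalIntegral.integral_mul_deriv_eq_deriv_mul (a := 0) (b := Real.pi)
    (fun x _ => Fw_dw a b r x) (fun x _ => theta_hasDeriv P hP x)
    (cww.intervalIntegrable _ _)
    ((theta_contDiff1 P hP).continuous.intervalIntegrable _ _)
  have hp := theta_periodic P 0
  rw [zero_add] at hp
  rw [e1, e2, FF_pi, Fw_pi, theta_deriv_pi, hp]
  ring

lemma k2_bnd (K r : ℝ) : |4*K^4*r^2 - 2*K^2| ≤ (4*K^4 + 2*K^2) * Real.cosh r ^ 2 := by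
  have h1 : r ^ 2 ≤ Real.cosh r ^ 2 := by
    rw [← sq_abs r]; exact pow_le_pow_left₀ (abs_nonneg _) (abs_le_cosh' r) 2
  have h2 : 1 ≤ Real.cosh r ^ 2 := one_le_pow₀ (Real.one_le_cosh r)
  have h3 : K^4*r^2 ≤ K^4 * Real.cosh r ^ 2 := by gcongr
  have h4 : K^2*1 ≤ K^2 * Real.cosh r ^ 2 := by gcongr
  have h5 : 0 ≤ K^4*r^2 := by positivity
  have h6 : 0 ≤ K^4 := by positivity
  have h7 : 0 ≤ K^2 := by positivity
  rw [abs_le]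
  constructor <;> nlinarith

lemma k1_bnd (K r : ℝ) : |-(2*K^2*r)| ≤ 2*K^2 * Real.cosh r := by
  rw [abs_neg, abs_mul, abs_of_nonneg (by positivity : 0 ≤ 2*K^2)]
  exact mul_le_mul_of_nonneg_left (abs_le_cosh' r) (by positivity)

lemma mulk (x m k X M : ℝ) (hx : |x| ≤ X) (hm : |m| ≤ M) (hk : 0 ≤ k) :
    |x * (m * k)| ≤ X * (M * k) := by
  rw [abs_mul, abs_mul, abs_of_nonneg hk]
  have := (abs_nonneg _).trans hx
  gcongr

lemma mulk1 (x k X : ℝ) (hx : |x| ≤ X) (hk : 0 ≤ k) : |x * k| ≤ X * k := by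
  rw [abs_mul, abs_of_nonneg hk]
  gcongr

lemma cosh_le_sq (r : ℝ) : Real.cosh r ≤ Real.cosh r ^ 2 := by
  nlinarith [Real.one_le_cosh r]

/-- partial integration in the radial variable -/
lemma ibp_r (K : ℝ) (hK : 0 < K) (a b ω : ℝ) :
    ∫ r : ℝ, FF a b r ω * ((4*K^4*r^2 - 2*K^2) * kfun K r) =
      ∫ r : ℝ, Frr a b r ω * kfun K r := by
  have c0 : Continuous (fun r => FF a b r ω) := Continuous.uncurry_right ω (FF_cont a b)
  have c1 : Continuous (fun r => Fr a b r ω) := Continuous.uncurry_right ω (Fr_cont a b)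
  have c2 : Continuous (fun r => Frr a b r ω) := Continuous.uncurry_right ω (Frr_cont a b)
  have ck := k_cont K
  have i1 : MeasureTheory.Integrable
      (fun r => FF a b r ω * ((4*K^4*r^2 - 2*K^2) * kfun K r)) := by
    apply int_of_bound K hK (4*K^4 + 2*K^2)
    · fun_prop
    · intro r
      refine (mulk _ _ _ _ _ (FF_bnd a b r ω) (k2_bnd K r) (k_nonneg K hK r)).trans (le_of_eq ?_)
      ring
  have i2 : MeasureTheory.Integrable (fun r => Fr a b r ω * (-(2*K^2*r) * kfun K r)) := by
    apply int_of_bound K hK (2 * (|a| + |b|) * (2 * K^2))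
    · fun_prop
    · intro r
      refine (mulk _ _ _ _ _ (Fr_bnd a b r ω) (k1_bnd K r) (k_nonneg K hK r)).trans (le_of_eq ?_)
      ring
  have i3 : MeasureTheory.Integrable (fun r => FF a b r ω * (-(2*K^2*r) * kfun K r)) := by
    apply int_of_bound K hK (2 * K^2)
    · fun_prop
    · intro r
      refine (mulk _ _ _ _ _ (FF_bnd a b r ω) (k1_bnd K r) (k_nonneg K hK r)).trans ?_
      have := mul_le_mul_of_nonneg_right (cosh_le_sq r) (k_nonneg K hK r)
      have := mul_le_mul_of_nonneg_left this (by positivity : 0 ≤ 2 * K^2)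
      linarith
  have i4 : MeasureTheory.Integrable (fun r => Frr a b r ω * kfun K r) := by
    apply int_of_bound K hK ((2 * (|a| + |b|)) ^ 2 + 2 * (|a| + |b|))
    · fun_prop
    · intro r
      refine (mulk1 _ _ _ (Frr_bnd a b r ω) (k_nonneg K hK r)).trans (le_of_eq ?_)
      ring
  have i5 : MeasureTheory.Integrable (fun r => Fr a b r ω * kfun K r) := by
    apply int_of_bound K hK (2 * (|a| + |b|))
    · fun_prop
    · intro r
      refine (mulk1 _ _ _ (Fr_bnd a b r ω) (k_nonneg K hK r)).trans ?_
      have := mul_le_mul_of_nonneg_right (cosh_le_sq r) (k_nonneg K hK r)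
      have := mul_le_mul_of_nonneg_left this (by positivity : 0 ≤ 2 * (|a| + |b|))
      linarith
  have e1 := MeasureTheory.integral_mul_deriv_eq_deriv_mul_of_integrable
    (fun x _ => FF_dr a b x ω) (fun x _ => k_hasDeriv2 K x) i1 i2 i3
  have e2 := MeasureTheory.integral_mul_deriv_eq_deriv_mul_of_integrable
    (fun x _ => Fr_dr a b x ω) (fun x _ => k_hasDeriv K x) i2 i4 i5
  rw [e1, e2, neg_neg]

/-- The radial part, after Fubini. -/
lemma radial_part (K P : ℝ) (hK : 0 < K) (hP : 0 < P) (a b : ℝ) :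
    ∫ r : ℝ, ∫ ω in Set.Ioc 0 Real.pi,
        FF a b r ω * ((4*K^4*r^2 - 2*K^2) * kfun K r) * thetafun P ω =
      ∫ r : ℝ, ∫ ω in Set.Ioc 0 Real.pi, Frr a b r ω * kfun K r * thetafun P ω := by
  have ct := (theta_contDiff P hP).continuous
  have ck := k_cont K
  have j1 := int_prod_of_bound K hK (4*K^4 + 2*K^2)
    (fun r ω => FF a b r ω * ((4*K^4*r^2 - 2*K^2) * kfun K r)) (thetafun P)
    ((FF_cont a b).mul (by fun_prop)) ct (by
      intro r ω
      refine (mulk _ _ _ _ _ (FF_bnd a b r ω) (k2_bnd K r) (k_nonneg K hK r)).trans (le_of_eq ?_)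
      ring)
  have j2 := int_prod_of_bound K hK ((2 * (|a| + |b|)) ^ 2 + 2 * (|a| + |b|))
    (fun r ω => Frr a b r ω * kfun K r) (thetafun P)
    ((Frr_cont a b).mul (by fun_prop)) ct (by
      intro r ω
      refine (mulk1 _ _ _ (Frr_bnd a b r ω) (k_nonneg K hK r)).trans (le_of_eq ?_)
      ring)
  rw [MeasureTheory.integral_integral_swap j1, MeasureTheory.integral_integral_swap j2]
  congr 1
  ext ω
  rw [MeasureTheory.integral_mul_const, MeasureTheory.integral_mul_const, ibp_r K hK]

lemma main_aux (K P : ℝ) (hK : 0 < K) (hP : 0 < P) (a b : ℝ) :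
    (-(∫ r : ℝ, ∫ ω in (0:ℝ)..Real.pi, FF a b r ω *
          (((4*K^4*r^2 - 2*K^2) * kfun K r) * thetafun P ω +
            kfun K r * deriv (deriv (thetafun P)) ω))) =
      4 * (a^2+b^2) *
        ∫ r : ℝ, ∫ ω in (0:ℝ)..Real.pi, FF a b r ω *
            ((Real.sinh r ^ 2 + Real.sin ω ^ 2) * kfun K r * thetafun P ω) := by
  have ct := (theta_contDiff P hP).continuous
  have ck := k_cont K
  have ct2 := theta_cont2 P hP
  have c0 : ∀ r, Continuous (fun ω => FF a b r ω) := fun r => Continuous.uncurry_left r (FF_cont a b)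
  have cr : ∀ r, Continuous (fun ω => Frr a b r ω) :=
    fun r => Continuous.uncurry_left r (Frr_cont a b)
  have cw : ∀ r, Continuous (fun ω => Fww a b r ω) :=
    fun r => Continuous.uncurry_left r (Fww_cont a b)
  have j1 := (int_prod_of_bound K hK (4*K^4 + 2*K^2)
    (fun r ω => FF a b r ω * ((4*K^4*r^2 - 2*K^2) * kfun K r)) (thetafun P)
    ((FF_cont a b).mul (by fun_prop)) ct (by
      intro r ω
      refine (mulk _ _ _ _ _ (FF_bnd a b r ω) (k2_bnd K r) (k_nonneg K hK r)).trans (le_of_eq ?_)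
      ring)).integral_prod_left
  have j2 := (int_prod_of_bound K hK ((2 * (|a| + |b|)) ^ 2 + 2 * (|a| + |b|))
    (fun r ω => Frr a b r ω * kfun K r) (thetafun P)
    ((Frr_cont a b).mul (by fun_prop)) ct (by
      intro r ω
      refine (mulk1 _ _ _ (Frr_bnd a b r ω) (k_nonneg K hK r)).trans (le_of_eq ?_)
      ring)).integral_prod_left
  have j3 := (int_prod_of_bound K hK ((2 * (|a| + |b|)) ^ 2 + 2 * (|a| + |b|))
    (fun r ω => Fww a b r ω * kfun K r) (thetafun P)
    ((Fww_cont a b).mul (by fun_prop)) ct (by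
      intro r ω
      refine (mulk1 _ _ _ (Fww_bnd a b r ω) (k_nonneg K hK r)).trans (le_of_eq ?_)
      ring)).integral_prod_left
  simp only [Function.uncurry] at j1 j2 j3
  have hrad := radial_part K P hK hP a b
  simp only [← intervalIntegral.integral_of_le Real.pi_pos.le] at j1 j2 j3 hrad
  have inner1 : ∀ r : ℝ, ∫ ω in (0:ℝ)..Real.pi, FF a b r ω *
          (((4*K^4*r^2 - 2*K^2) * kfun K r) * thetafun P ω +
            kfun K r * deriv (deriv (thetafun P)) ω) =
      (∫ ω in (0:ℝ)..Real.pi, FF a b r ω * ((4*K^4*r^2 - 2*K^2) * kfun K r) * thetafun P ω) +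
        ∫ ω in (0:ℝ)..Real.pi, Fww a b r ω * kfun K r * thetafun P ω := by
    intro r
    have c0 := c0 r
    have cw := cw r
    have e : ∫ ω in (0:ℝ)..Real.pi, Fww a b r ω * kfun K r * thetafun P ω =
        ∫ ω in (0:ℝ)..Real.pi, kfun K r * (FF a b r ω * deriv (deriv (thetafun P)) ω) := by
      rw [intervalIntegral.integral_const_mul, ibp_w P hP, ← intervalIntegral.integral_const_mul]
      congr 1; ext ω; ring
    rw [e, ← intervalIntegral.integral_add]
    · congr 1; ext ω; ring
    · exact Continuous.intervalIntegrable (by fun_prop) _ _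
    · exact Continuous.intervalIntegrable (by fun_prop) _ _
  simp only [inner1]
  rw [MeasureTheory.integral_add j1 j3, hrad, ← MeasureTheory.integral_add j2 j3,
    ← MeasureTheory.integral_neg, ← MeasureTheory.integral_const_mul]
  congr 1
  ext r
  have cr := cr r
  have cw := cw r
  rw [← intervalIntegral.integral_add, ← intervalIntegral.integral_neg,
    ← intervalIntegral.integral_const_mul]
  · congr 1; ext ω
    linear_combination (-(kfun K r * thetafun P ω)) * laplace a b r ω
  · exact Continuous.intervalIntegrable (by fun_prop) _ _
  · exact Continuous.intervalIntegrable (by fun_prop) _ _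

/-- Partial-integration identity:
`−∫∫ cos(2Re(z trh(r,ω))) (k''θ + kθ'') = 4|z|² ∫∫ cos(2Re(z trh(r,ω))) (sinh²r + sin²ω) k θ`. -/
theorem bessel_integral_partial_integration (K P : ℝ) (hK : 0 < K) (hP : 0 < P) (z : ℂ) :
    (-(∫ r : ℝ, ∫ ω in (0:ℝ)..Real.pi,
        Real.cos (2 * (z * trh r ω).re) *
          (deriv (deriv (kfun K)) r * thetafun P ω +
            kfun K r * deriv (deriv (thetafun P)) ω))) =
      4 * ‖z‖ ^ 2 *
        ∫ r : ℝ, ∫ ω in (0:ℝ)..Real.pi,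
          Real.cos (2 * (z * trh r ω).re) *
            ((Real.sinh r ^ 2 + Real.sin ω ^ 2) * kfun K r * thetafun P ω) := by
  have hF : ∀ r ω, Real.cos (2 * (z * trh r ω).re) = FF z.re z.im r ω := by
    intro r ω
    unfold FF uu trh
    congr 2
    simp only [Complex.mul_re, Complex.add_re, Complex.add_im, Complex.mul_im, Complex.ofReal_re,
      Complex.ofReal_im, Complex.I_re, Complex.I_im]
    ring
  have hz : ‖z‖ ^ 2 = z.re ^ 2 + z.im ^ 2 := by
    rw [Complex.sq_norm, Complex.normSq_apply]; ring
  simp only [hF, hz, k_deriv2]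
  exact main_aux K P hK hP z.re z.im
end
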